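/- arXiv:2209.09167 — 5 statements merged into one kernel-verified Lean document; each statement's English description precedes it below -/
import Mathlib

section
/- Let Ω ⊆ ℝⁿ and p ∈ (0,1]. For all balanced signed finite Radon measures μ, ν on Ω (i.e. μ(Ω) = ν(Ω) = 0), one has W_p((ν+μ)⁺, (ν+μ)⁻) ≤ W_p(ν⁺, ν⁻) + W_p(μ⁺, μ⁻). -/
open MeasureTheory ENNReal

noncomputable section

variable {X : Type*} [MeasurableSpace X]

/-- Couplings (transport plans) between two nonnegative measures. -/
def couplings (ρ₁ ρ₂ : Measure X) : Set (Measure (X × X)) :=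
  {γ | γ.map Prod.fst = ρ₁ ∧ γ.map Prod.snd = ρ₂}

/-- The transport cost of a plan for the cost `|x-y|^p`. -/
def transportCost [PseudoMetricSpace X] (p : ℝ) (γ : Measure (X × X)) : ℝ≥0∞ :=
  ∫⁻ z, ENNReal.ofReal (dist z.1 z.2 ^ p) ∂γ

/-- The `p`-Wasserstein cost `W_p` (no `1/p`-th power is taken); it is `∞` if
there is no coupling. -/
def W [PseudoMetricSpace X] (p : ℝ) (ρ₁ ρ₂ : Measure X) : ℝ≥0∞ :=
  ⨅ (γ : Measure (X × X)) (_ : γ ∈ couplings ρ₁ ρ₂), transportCost p γ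

/-- Positive part `μ⁺` of the Hahn-Jordan decomposition. -/
def pos (μ : SignedMeasure X) : Measure X := μ.toJordanDecomposition.posPart

/-- Negative part `μ⁻` of the Hahn-Jordan decomposition. -/
def neg (μ : SignedMeasure X) : Measure X := μ.toJordanDecomposition.negPart

/-- Total variation `|μ|(Ω)`. -/
def tv (μ : SignedMeasure X) : ℝ≥0∞ := μ.totalVariation Set.univ

/-- The generalized Kantorovich-Rubinstein norm `‖μ‖_{KR_p^{α,β}}`. -/
def KRnorm [PseudoMetricSpace X] (p α β : ℝ) (μ : SignedMeasure X) : ℝ≥0∞ :=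
  ⨅ (ν : SignedMeasure X) (_ : ν Set.univ = 0),
    W p (pos ν) (neg ν) + ENNReal.ofReal (β / 2) * tv ν + ENNReal.ofReal α * tv (μ - ν)

/-- Dirac delta `δ_x` as a signed measure. -/
def sDirac (x : X) : SignedMeasure X := (Measure.dirac x).toSignedMeasure

/-- Duality pairing `∫ q dμ` of a continuous function against a signed measure. -/
def pairing [TopologicalSpace X] (q : C(X, ℝ)) (μ : SignedMeasure X) : ℝ :=
  ∫ x, q x ∂(pos μ) - ∫ x, q x ∂(neg μ)

/-- The weak* topology on signed measures, induced by testing against `C₀` functions. -/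
def weakStar (X : Type*) [MeasurableSpace X] [TopologicalSpace X] :
    TopologicalSpace (SignedMeasure X) :=
  TopologicalSpace.induced
    (fun μ => fun f : ZeroAtInftyContinuousMap X ℝ =>
      ∫ x, f x ∂(pos μ) - ∫ x, f x ∂(neg μ))
    Pi.topologicalSpace

/-- Support of a nonnegative measure. -/
def msupport [TopologicalSpace X] (μ : Measure X) : Set X :=
  {x | ∀ U : Set X, IsOpen U → x ∈ U → μ U ≠ 0}

end

section TransportMatrix

open Filter Topology

variable {ι : Type*}

/-- Replacing mass moving into and out of `k` by mass that bypasses `k` keeps the row and column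
sums outside `k` and does not increase the total cost. -/
lemma exists_bypass [DecidableEq ι] (c : ι → ι → ℝ≥0∞) (k : ι)
    (hc : ∀ i j, c i j ≤ c i k + c k j) (ρ : ι → ι → ℝ≥0∞) (u v : ι → ℝ≥0∞) {t : ℝ≥0∞}
    (ht0 : t ≠ 0) (ht : t ≠ ∞) (hu : ∑' i, u i = t) (hv : ∑' j, v j = t)
    (π : ι → ι → ℝ≥0∞)
    (hπ : ∀ i j, π i j = ρ i j + (if j = k then u i else 0) + (if i = k then v j else 0)) :
    ∃ π' : ι → ι → ℝ≥0∞,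
      (∀ i, ∑' j, π i j = ∑' j, π' i j + if i = k then t else 0) ∧
      (∀ j, ∑' i, π i j = ∑' i, π' i j + if j = k then t else 0) ∧
      ∑' i, ∑' j, c i j * π' i j ≤ ∑' i, ∑' j, c i j * π i j := by
  have hone : t * t⁻¹ = 1 := ENNReal.mul_inv_cancel ht0 ht
  refine ⟨fun i j => ρ i j + u i * v j * t⁻¹, fun i => ?_, fun j => ?_, ?_⟩
  · simp only [hπ, ENNReal.tsum_add, tsum_ite_eq, ENNReal.tsum_mul_right, ENNReal.tsum_mul_left,
      hv, mul_assoc, hone, mul_one]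
    split_ifs <;> simp [hv]
  · simp only [hπ, ENNReal.tsum_add, tsum_ite_eq, ENNReal.tsum_mul_right, hu]
    rw [mul_right_comm, hone, one_mul]
    split_ifs <;> simp [hu, add_right_comm]
  · have hin : ∑' i, ∑' j, c i j * (if j = k then u i else 0) = ∑' i, c i k * u i := by
      refine tsum_congr fun i => ?_
      rw [tsum_eq_single k fun j hj => by simp [hj]]
      simp
    have hout : ∑' i, ∑' j, c i j * (if i = k then v j else 0) = ∑' j, c k j * v j := by
      rw [tsum_eq_single k fun i hi => by simp [hi]]
      simp
    simp only [hπ, mul_add, ENNReal.tsum_add, hin, hout, add_assoc]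
    refine add_le_add_right ?_ _
    calc ∑' i, ∑' j, c i j * (u i * v j * t⁻¹)
        ≤ ∑' i, ∑' j, (c i k * u i * (v j * t⁻¹) + u i * (c k j * v j * t⁻¹)) := by
          refine ENNReal.tsum_le_tsum fun i => ENNReal.tsum_le_tsum fun j => ?_
          calc c i j * (u i * v j * t⁻¹) ≤ (c i k + c k j) * (u i * v j * t⁻¹) := by
                gcongr; exact hc i j
            _ = _ := by ring
      _ = ∑' i, c i k * u i + ∑' j, c k j * v j := by
          simp only [ENNReal.tsum_add, ENNReal.tsum_mul_left, ENNReal.tsum_mul_right, hv, hu, hone,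
            mul_one]
          rw [mul_left_comm, hone, mul_one]

lemma exists_remove_diagonal [DecidableEq ι] (c : ι → ι → ℝ≥0∞) (k : ι) (π : ι → ι → ℝ≥0∞)
    {m : ℝ≥0∞} (hm : m ≤ π k k) :
    ∃ π' : ι → ι → ℝ≥0∞, π' k k = π k k - m ∧
      (∀ i, ∑' j, π i j = ∑' j, π' i j + if i = k then m else 0) ∧
      (∀ j, ∑' i, π i j = ∑' i, π' i j + if j = k then m else 0) ∧
      ∑' i, ∑' j, c i j * π' i j ≤ ∑' i, ∑' j, c i j * π i j := by
  obtain ⟨π', hπ', h⟩ : ∃ π' : ι → ι → ℝ≥0∞, π' k k = π k k - m ∧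
      ∀ i j, π i j = π' i j + if i = k then (if j = k then m else 0) else 0 := by
    refine ⟨fun i j => if i = k ∧ j = k then π k k - m else π i j, by simp, fun i j => ?_⟩
    by_cases hi : i = k <;> by_cases hj : j = k <;> simp [hi, hj, tsub_add_cancel_of_le hm]
  refine ⟨π', hπ', fun i => ?_, fun j => ?_, ?_⟩
  · simp only [h, ENNReal.tsum_add]
    split_ifs <;> simp
  · simp only [h, ENNReal.tsum_add, tsum_ite_eq]
  · gcongr with i j
    rw [h]
    exact le_self_add

lemma exists_remove_of_diagonal_eq_zero [DecidableEq ι] (c : ι → ι → ℝ≥0∞) (k : ι)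
    (hc : ∀ i j, c i j ≤ c i k + c k j) (π : ι → ι → ℝ≥0∞) {t : ℝ≥0∞}
    (hk : π k k = 0) (hrow : t ≤ ∑' j, π k j) (hcol : t ≤ ∑' i, π i k)
    (hrow' : ∑' j, π k j ≠ ∞) (hcol' : ∑' i, π i k ≠ ∞) :
    ∃ π' : ι → ι → ℝ≥0∞,
      (∀ i, ∑' j, π i j = ∑' j, π' i j + if i = k then t else 0) ∧
      (∀ j, ∑' i, π i j = ∑' i, π' i j + if j = k then t else 0) ∧
      ∑' i, ∑' j, c i j * π' i j ≤ ∑' i, ∑' j, c i j * π i j := by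
  rcases eq_or_ne t 0 with rfl | ht
  · exact ⟨π, by simp, by simp, le_rfl⟩
  have htop : t ≠ ∞ := ne_top_of_le_ne_top hrow' hrow
  set U := ∑' i, π i k with hU
  set V := ∑' j, π k j with hV
  have hU0 : U ≠ 0 := fun h => ht (by simpa [h] using hcol)
  have hV0 : V ≠ 0 := fun h => ht (by simpa [h] using hrow)
  have hUt : t / U ≤ 1 := ENNReal.div_le_of_le_mul (by simpa using hcol)
  have hVt : t / V ≤ 1 := ENNReal.div_le_of_le_mul (by simpa using hrow)
  refine exists_bypass c k hc
    (fun i j => if i = k then π k j * (1 - t / V) else if j = k then π i k * (1 - t / U) else π i j)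
    (fun i => π i k * (t / U)) (fun j => π k j * (t / V)) ht htop ?_ ?_ π fun i j => ?_
  · rw [ENNReal.tsum_mul_right, ← hU, ENNReal.mul_div_cancel hU0 hcol']
  · rw [ENNReal.tsum_mul_right, ← hV, ENNReal.mul_div_cancel hV0 hrow']
  · by_cases hi : i = k <;> by_cases hj : j = k <;>
      simp [hi, hj, hk, ← mul_add, tsub_add_cancel_of_le hUt, tsub_add_cancel_of_le hVt]

/-- Common mass `t` at the index `k` can be removed from both marginals of a transport matrix
without increasing the cost. -/
lemma exists_remove [DecidableEq ι] (c : ι → ι → ℝ≥0∞) (k : ι)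
    (hc : ∀ i j, c i j ≤ c i k + c k j) (a b : ι → ℝ≥0∞) {t : ℝ≥0∞}
    (ha : a k ≠ ∞) (hb : b k ≠ ∞) (ht : t ≠ ∞) (π : ι → ι → ℝ≥0∞)
    (hrow : ∀ i, ∑' j, π i j = a i + if i = k then t else 0)
    (hcol : ∀ j, ∑' i, π i j = b j + if j = k then t else 0) :
    ∃ π' : ι → ι → ℝ≥0∞, (∀ i, ∑' j, π' i j = a i) ∧ (∀ j, ∑' i, π' i j = b j) ∧
      ∑' i, ∑' j, c i j * π' i j ≤ ∑' i, ∑' j, c i j * π i j := by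
  obtain ⟨m, hm_eq⟩ : ∃ m, m = min (π k k) t := ⟨_, rfl⟩
  have hm_le : m ≤ t := hm_eq.trans_le (min_le_right _ _)
  have hm : m ≠ ∞ := ne_top_of_le_ne_top ht hm_le
  have hmt : t - m + m = t := tsub_add_cancel_of_le hm_le
  obtain ⟨π₁, hd₁, hrow₁, hcol₁, hcost₁⟩ :=
    exists_remove_diagonal c k π (hm_eq.trans_le (min_le_left _ _))
  have hrow₁' : ∀ i, ∑' j, π₁ i j = a i + if i = k then t - m else 0 := fun i => by
    have := (hrow₁ i).symm.trans (hrow i)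
    split_ifs at this ⊢ with hi
    · rw [← hmt, ← add_assoc] at this
      exact (ENNReal.add_left_inj hm).1 this
    · simpa using this
  have hcol₁' : ∀ j, ∑' i, π₁ i j = b j + if j = k then t - m else 0 := fun j => by
    have := (hcol₁ j).symm.trans (hcol j)
    split_ifs at this ⊢ with hj
    · rw [← hmt, ← add_assoc] at this
      exact (ENNReal.add_left_inj hm).1 this
    · simpa using this
  rcases le_total t (π k k) with h | h
  · have : t - m = 0 := by simp [hm_eq, h]
    exact ⟨π₁, by simpa [this] using hrow₁', by simpa [this] using hcol₁', hcost₁⟩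
  · have hzero : π₁ k k = 0 := by simp [hd₁, hm_eq, h]
    have htm : t - m ≠ ∞ := ne_top_of_le_ne_top ht tsub_le_self
    obtain ⟨π₂, hrow₂, hcol₂, hcost₂⟩ := exists_remove_of_diagonal_eq_zero c k hc π₁ (t := t - m)
      hzero (by simp [hrow₁']) (by simp [hcol₁']) (by simp [hrow₁', ha, htm])
      (by simp [hcol₁', hb, htm])
    refine ⟨π₂, fun i => ?_, fun j => ?_, hcost₂.trans hcost₁⟩
    · exact (ENNReal.add_left_inj (by split_ifs <;> simp [htm])).1
        ((hrow₂ i).symm.trans (hrow₁' i))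
    · exact (ENNReal.add_left_inj (by split_ifs <;> simp [htm])).1
        ((hcol₂ j).symm.trans (hcol₁' j))

lemma exists_remove_below (c : ℕ → ℕ → ℝ≥0∞) (hc : ∀ i j k, c i j ≤ c i k + c k j)
    (a b s : ℕ → ℝ≥0∞) (ha : ∀ i, a i ≠ ∞) (hb : ∀ i, b i ≠ ∞) (hs : ∀ i, s i ≠ ∞)
    (π : ℕ → ℕ → ℝ≥0∞) (hrow : ∀ i, ∑' j, π i j = a i + s i)
    (hcol : ∀ j, ∑' i, π i j = b j + s j) (n : ℕ) :
    ∃ π' : ℕ → ℕ → ℝ≥0∞, (∀ i, ∑' j, π' i j = a i + if n ≤ i then s i else 0) ∧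
      (∀ j, ∑' i, π' i j = b j + if n ≤ j then s j else 0) ∧
      ∑' i, ∑' j, c i j * π' i j ≤ ∑' i, ∑' j, c i j * π i j := by
  induction n with
  | zero => exact ⟨π, by simpa using hrow, by simpa using hcol, le_rfl⟩
  | succ n ih =>
    obtain ⟨π₁, hrow₁, hcol₁, hcost₁⟩ := ih
    have key : ∀ i, (if n ≤ i then s i else 0) =
        (if n + 1 ≤ i then s i else 0) + if i = n then s n else 0 := fun i => by
      rcases lt_trichotomy i n with h | rfl | h
      · simp [h.not_ge, h.ne, (h.trans n.lt_succ_self).not_ge]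
      · simp
      · simp [h.le, h.ne', Nat.succ_le_of_lt h]
    obtain ⟨π₂, hrow₂, hcol₂, hcost₂⟩ := exists_remove c n (fun i j => hc i j n)
      (fun i => a i + if n + 1 ≤ i then s i else 0) (fun i => b i + if n + 1 ≤ i then s i else 0)
      (by simp [ha]) (by simp [hb]) (hs n) π₁
      (fun i => by rw [hrow₁, key, add_assoc]) (fun j => by rw [hcol₁, key, add_assoc])
    exact ⟨π₂, hrow₂, hcol₂, hcost₂.trans hcost₁⟩

/-- The limit of row sums of an entrywise convergent, dominated sequence of matrices. -/
lemma tsum_eq_of_tendsto_of_eventually_eq {f : ℕ → ℕ → ℝ≥0∞} {g bound : ℕ → ℝ≥0∞} {l : ℝ≥0∞}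
    (hbound : ∑' j, bound j ≠ ∞) (hle : ∀ n j, f n j ≤ bound j)
    (hlim : ∀ j, Tendsto (fun n => f n j) atTop (𝓝 (g j)))
    (hsum : ∀ᶠ n in atTop, ∑' j, f n j = l) : ∑' j, g j = l := by
  have h := tendsto_lintegral_of_dominated_convergence (μ := Measure.count) (F := f) (f := g) bound
    (fun n => measurable_of_countable _) (fun n => Eventually.of_forall (hle n))
    (by rwa [lintegral_count]) (Eventually.of_forall hlim)
  simp only [lintegral_count] at h
  exact tendsto_nhds_unique h (tendsto_const_nhds.congr' (hsum.mono fun _ h => h.symm))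

/-- A common summable part `s` of both marginals of a transport matrix can be removed without
increasing the cost. -/
lemma exists_remove_common (c : ℕ → ℕ → ℝ≥0∞) (hc : ∀ i j k, c i j ≤ c i k + c k j)
    (hctop : ∀ i j, c i j ≠ ∞) (a b s : ℕ → ℝ≥0∞) (ha : ∑' i, a i ≠ ∞) (hb : ∑' i, b i ≠ ∞)
    (hs : ∑' i, s i ≠ ∞) (π : ℕ → ℕ → ℝ≥0∞) (hrow : ∀ i, ∑' j, π i j = a i + s i)
    (hcol : ∀ j, ∑' i, π i j = b j + s j) :
    ∃ π' : ℕ → ℕ → ℝ≥0∞, (∀ i, ∑' j, π' i j = a i) ∧ (∀ j, ∑' i, π' i j = b j) ∧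
      ∑' i, ∑' j, c i j * π' i j ≤ ∑' i, ∑' j, c i j * π i j := by
  choose π' hrow' hcol' hcost' using exists_remove_below c hc a b s (ENNReal.ne_top_of_tsum_ne_top ha)
    (ENNReal.ne_top_of_tsum_ne_top hb) (ENNReal.ne_top_of_tsum_ne_top hs) π hrow hcol
  obtain ⟨L, φ, hφ, hL⟩ := SeqCompactSpace.tendsto_subseq π'
  have hlim : ∀ i j, Tendsto (fun n => π' (φ n) i j) atTop (𝓝 (L i j)) := fun i j =>
    (tendsto_pi_nhds.1 (tendsto_pi_nhds.1 hL i) j)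
  have hdrop : ∀ (d : ℕ → ℝ≥0∞) i, ∀ᶠ n in atTop, (d i + if φ n ≤ i then s i else 0) = d i :=
    fun d i => by
      filter_upwards [hφ.tendsto_atTop.eventually_gt_atTop i] with n hn
      simp [hn.not_ge]
  have hdom : ∀ (d : ℕ → ℝ≥0∞) n i, (d i + if n ≤ i then s i else 0) ≤ d i + s i :=
    fun d n i => by gcongr; split_ifs <;> simp
  refine ⟨L, fun i => ?_, fun j => ?_, ?_⟩
  · refine tsum_eq_of_tendsto_of_eventually_eq (bound := fun j => b j + s j)
      (by simp [ENNReal.tsum_add, hb, hs]) (fun n j => ?_) (hlim i)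
      ((hdrop a i).mono fun n hn => (hrow' (φ n) i).trans hn)
    calc π' (φ n) i j ≤ ∑' i, π' (φ n) i j := ENNReal.le_tsum (f := fun i => π' (φ n) i j) i
      _ ≤ b j + s j := (hcol' (φ n) j).trans_le (hdom b _ _)
  · refine tsum_eq_of_tendsto_of_eventually_eq (bound := fun i => a i + s i)
      (by simp [ENNReal.tsum_add, ha, hs]) (fun n i => ?_) (fun i => hlim i j)
      ((hdrop b j).mono fun n hn => (hcol' (φ n) j).trans hn)
    calc π' (φ n) i j ≤ ∑' j, π' (φ n) i j := ENNReal.le_tsum j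
      _ ≤ a i + s i := (hrow' (φ n) i).trans_le (hdom a _ _)
  · rw [← ENNReal.tsum_prod, ENNReal.tsum_eq_iSup_sum]
    refine iSup_le fun F => le_of_tendsto' (tendsto_finsetSum F fun z _ =>
      ENNReal.Tendsto.const_mul (hlim z.1 z.2) (Or.inr (hctop _ _))) fun n => ?_
    refine (ENNReal.sum_le_tsum F).trans ?_
    rw [ENNReal.tsum_prod (f := fun i j => c i j * π' (φ n) i j)]
    exact hcost' (φ n)

end TransportMatrix

section Coupling

open Filter Topology

lemma ofReal_dist_rpow_triangle {X : Type*} [PseudoMetricSpace X] {p : ℝ} (hp0 : 0 < p)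
    (hp1 : p ≤ 1) (x y z : X) : ENNReal.ofReal (dist x z ^ p) ≤
      ENNReal.ofReal (dist x y ^ p) + ENNReal.ofReal (dist y z ^ p) := by
  rw [← ENNReal.ofReal_add (by positivity) (by positivity)]
  exact ENNReal.ofReal_le_ofReal ((Real.rpow_le_rpow dist_nonneg (dist_triangle x y z) hp0.le).trans
    (Real.rpow_add_le_add_rpow dist_nonneg dist_nonneg hp0.le hp1))

variable {X : Type*} [MeasurableSpace X]

lemma tsum_measure_inter_preimage_singleton (a : Measure X) {f : X → ℕ} (hf : Measurable f)
    {S : Set X} (hS : MeasurableSet S) : ∑' i, a (S ∩ f ⁻¹' {i}) = a S := by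
  rw [← measure_iUnion (fun i j hij => ?_) fun i => hS.inter (hf (measurableSet_singleton i))]
  · rw [← Set.inter_iUnion, ← Set.preimage_iUnion, Set.iUnion_of_singleton, Set.preimage_univ,
      Set.inter_univ]
  · exact (Disjoint.preimage f (Set.disjoint_singleton.2 hij)).mono Set.inter_subset_right
      Set.inter_subset_right

/-- A transport matrix between the masses of the pieces of a countable partition is realized by a
coupling that is a product measure on each pair of pieces. -/
lemma exists_coupling_of_matrix (a b : Measure X) [IsFiniteMeasure a] [IsFiniteMeasure b]
    {f : X → ℕ} (hf : Measurable f) (q : ℕ → ℕ → ℝ≥0∞)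
    (hrow : ∀ i, ∑' j, q i j = a (f ⁻¹' {i})) (hcol : ∀ j, ∑' i, q i j = b (f ⁻¹' {j})) :
    ∃ γ ∈ couplings a b, ∀ (h : X × X → ℝ≥0∞) (c : ℕ → ℕ → ℝ≥0∞),
      (∀ x y, h (x, y) ≤ c (f x) (f y)) → ∫⁻ z, h z ∂γ ≤ ∑' i, ∑' j, c i j * q i j := by
  set A : ℕ → Set X := fun i => f ⁻¹' {i}
  have hA : ∀ i, MeasurableSet (A i) := fun i => hf (measurableSet_singleton i)
  have hqa : ∀ i j, a (A i) = 0 → q i j = 0 := fun i j h =>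
    le_antisymm ((ENNReal.le_tsum j).trans ((hrow i).trans_le h.le)) zero_le
  have hqb : ∀ i j, b (A j) = 0 → q i j = 0 := fun i j h =>
    le_antisymm ((ENNReal.le_tsum (f := fun i => q i j) i).trans ((hcol j).trans_le h.le)) zero_le
  have cancel : ∀ q u v r : ℝ≥0∞, v ≠ ∞ → (v = 0 → q = 0) →
      q * (u * v)⁻¹ * (r * v) = q * (u⁻¹ * r) := by
    intro q u v r hv hq
    rcases eq_or_ne v 0 with h0 | h0
    · simp [hq h0]
    · rw [ENNReal.mul_inv (Or.inr hv) (Or.inr h0)]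
      calc q * (u⁻¹ * v⁻¹) * (r * v) = q * (u⁻¹ * r) * (v * v⁻¹) := by ring
        _ = _ := by rw [ENNReal.mul_inv_cancel h0 hv, mul_one]
  have cancel' : ∀ u r : ℝ≥0∞, u ≠ ∞ → (u = 0 → r = 0) → u * (u⁻¹ * r) = r := by
    intro u r hu hr
    rcases eq_or_ne u 0 with h0 | h0
    · simp [hr h0]
    · rw [← mul_assoc, ENNReal.mul_inv_cancel h0 hu, one_mul]
  refine ⟨Measure.sum fun z : ℕ × ℕ => (q z.1 z.2 * (a (A z.1) * b (A z.2))⁻¹) •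
    (a.restrict (A z.1)).prod (b.restrict (A z.2)), ⟨?_, ?_⟩, fun h c hc => ?_⟩
  · ext S hS
    rw [Measure.map_apply measurable_fst hS, Measure.sum_apply _ (measurable_fst hS),
      ENNReal.tsum_prod', ← tsum_measure_inter_preimage_singleton a hf hS]
    refine tsum_congr fun i => ?_
    have : ∀ j, ((q i j * (a (A i) * b (A j))⁻¹) • (a.restrict (A i)).prod (b.restrict (A j)))
        (Prod.fst ⁻¹' S) = q i j * ((a (A i))⁻¹ * a (S ∩ A i)) := fun j => by
      rw [← Set.prod_univ, Measure.smul_apply, Measure.prod_prod, Measure.restrict_apply hS,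
        Measure.restrict_apply_univ, smul_eq_mul, cancel _ _ _ _ (measure_ne_top _ _) (hqb i j)]
    simp only [this, ENNReal.tsum_mul_right, hrow]
    exact cancel' _ _ (measure_ne_top _ _) (measure_mono_null Set.inter_subset_right)
  · ext S hS
    rw [Measure.map_apply measurable_snd hS, Measure.sum_apply _ (measurable_snd hS),
      ENNReal.tsum_prod', ENNReal.tsum_comm, ← tsum_measure_inter_preimage_singleton b hf hS]
    refine tsum_congr fun j => ?_
    have : ∀ i, ((q i j * (a (A i) * b (A j))⁻¹) • (a.restrict (A i)).prod (b.restrict (A j)))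
        (Prod.snd ⁻¹' S) = q i j * ((b (A j))⁻¹ * b (S ∩ A j)) := fun i => by
      rw [← Set.univ_prod, Measure.smul_apply, Measure.prod_prod, Measure.restrict_apply hS,
        Measure.restrict_apply_univ, smul_eq_mul, mul_comm (a (A i)), mul_comm (a (A i)),
        cancel _ _ _ _ (measure_ne_top _ _) (hqa i j)]
    simp only [this, ENNReal.tsum_mul_right, hcol]
    exact cancel' _ _ (measure_ne_top _ _) (measure_mono_null Set.inter_subset_right)
  · rw [lintegral_sum_measure, ENNReal.tsum_prod']
    refine ENNReal.tsum_le_tsum fun i => ENNReal.tsum_le_tsum fun j => ?_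
    rw [lintegral_smul_measure, Measure.prod_restrict, smul_eq_mul]
    calc q i j * (a (A i) * b (A j))⁻¹ * ∫⁻ z in A i ×ˢ A j, h z ∂a.prod b
        ≤ q i j * (a (A i) * b (A j))⁻¹ * ∫⁻ _ in A i ×ˢ A j, c i j ∂a.prod b := by
          refine mul_le_mul_right ?_ _
          refine setLIntegral_mono' ((hA i).prod (hA j)) fun z hz => ?_
          obtain ⟨h₁, h₂⟩ : f z.1 = i ∧ f z.2 = j := hz
          simpa [h₁, h₂] using hc z.1 z.2
      _ = c i j * q i j * ((a (A i) * b (A j)) * (a (A i) * b (A j))⁻¹) := by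
          rw [setLIntegral_const, Measure.prod_prod]; ring
      _ ≤ c i j * q i j := mul_le_of_le_one_right' (ENNReal.mul_inv_le_one _)

lemma tsum_measure_singleton_prod (m : Measure (ℕ × ℕ)) (i : ℕ) :
    ∑' j, m {(i, j)} = m.map Prod.fst {i} := by
  rw [Measure.map_apply measurable_fst (measurableSet_singleton i),
    ← measure_iUnion (fun j k hjk => by simpa using hjk) fun j => measurableSet_singleton _]
  congr 1
  ext ⟨x, y⟩
  simp [eq_comm]

lemma tsum_measure_prod_singleton (m : Measure (ℕ × ℕ)) (j : ℕ) :
    ∑' i, m {(i, j)} = m.map Prod.snd {j} := by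
  rw [Measure.map_apply measurable_snd (measurableSet_singleton j),
    ← measure_iUnion (fun i k hik => by simpa using hik) fun i => measurableSet_singleton _]
  congr 1
  ext ⟨x, y⟩
  simp [eq_comm]

/-- A separable space has a countable measurable partition into pieces close to given points. -/
lemma exists_measurable_dist_lt [PseudoMetricSpace X] [OpensMeasurableSpace X]
    [TopologicalSpace.SeparableSpace X] [Nonempty X] {δ : ℝ} (hδ : 0 < δ) :
    ∃ (f : X → ℕ) (x : ℕ → X), Measurable f ∧ ∀ y, dist y (x (f y)) < δ := by
  classical
  have hex : ∀ y : X, ∃ n, dist y (TopologicalSpace.denseSeq X n) < δ := fun y =>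
    (TopologicalSpace.denseRange_denseSeq X).exists_dist_lt y hδ
  exact ⟨fun y => Nat.find (hex y), TopologicalSpace.denseSeq X,
    measurable_find hex fun n => Metric.isOpen_ball.measurableSet, fun y => Nat.find_spec (hex y)⟩

/-- A common part of both marginals of a coupling can be removed without increasing the Wasserstein
cost, because `dist ^ p` satisfies the triangle inequality. -/
lemma W_le_transportCost_of_mem_couplings_add [PseudoMetricSpace X] [OpensMeasurableSpace X]
    [TopologicalSpace.SeparableSpace X] {p : ℝ} (hp0 : 0 < p) (hp1 : p ≤ 1) (a b s : Measure X)
    [IsFiniteMeasure a] [IsFiniteMeasure b] [IsFiniteMeasure s] {γ : Measure (X × X)}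
    (hγ : γ ∈ couplings (a + s) (b + s)) : W p a b ≤ transportCost p γ := by
  rcases isEmpty_or_nonempty X with hX | hX
  · exact iInf₂_le γ ⟨Subsingleton.elim _ _, Subsingleton.elim _ _⟩
  have hmass : γ Set.univ = (a + s) Set.univ := by
    rw [← hγ.1, Measure.map_apply measurable_fst .univ, Set.preimage_univ]
  have bound : ∀ δ : ℝ, 0 < δ → W p a b ≤ transportCost p γ +
      2 * ENNReal.ofReal (δ ^ p) * ((a + s) Set.univ + a Set.univ) := by
    intro δ hδ
    obtain ⟨f, x, hf, hx⟩ := exists_measurable_dist_lt (X := X) hδ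
    set η := ENNReal.ofReal (δ ^ p)
    set c : ℕ → ℕ → ℝ≥0∞ := fun i j => ENNReal.ofReal (dist (x i) (x j) ^ p)
    have hη : ∀ y, ENNReal.ofReal (dist y (x (f y)) ^ p) ≤ η := fun y =>
      ENNReal.ofReal_le_ofReal (Real.rpow_le_rpow dist_nonneg (hx y).le hp0.le)
    have hη' : ∀ y, ENNReal.ofReal (dist (x (f y)) y ^ p) ≤ η := fun y => dist_comm y _ ▸ hη y
    have hle : ∀ y z, ENNReal.ofReal (dist y z ^ p) ≤ c (f y) (f z) + 2 * η := fun y z => by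
      calc ENNReal.ofReal (dist y z ^ p) ≤ η + (c (f y) (f z) + η) :=
            (ofReal_dist_rpow_triangle hp0 hp1 y (x (f y)) z).trans (add_le_add (hη y)
              ((ofReal_dist_rpow_triangle hp0 hp1 _ (x (f z)) z).trans
                (add_le_add_right (hη' z) _)))
        _ = _ := by ring
    have hge : ∀ y z, c (f y) (f z) ≤ ENNReal.ofReal (dist y z ^ p) + 2 * η := fun y z => by
      calc c (f y) (f z) ≤ η + (ENNReal.ofReal (dist y z ^ p) + η) :=
            (ofReal_dist_rpow_triangle hp0 hp1 _ y _).trans (add_le_add (hη' y)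
              ((ofReal_dist_rpow_triangle hp0 hp1 y z _).trans (add_le_add_right (hη z) _)))
        _ = _ := by ring
    have hF : Measurable (Prod.map f f) := hf.prodMap hf
    set m := γ.map (Prod.map f f)
    have hm₁ : m.map Prod.fst = (a + s).map f := by
      rw [← hγ.1, Measure.map_map measurable_fst hF, Measure.map_map hf measurable_fst]; rfl
    have hm₂ : m.map Prod.snd = (b + s).map f := by
      rw [← hγ.2, Measure.map_map measurable_snd hF, Measure.map_map hf measurable_snd]; rfl
    have hsum : ∀ (d : Measure X), ∑' i, d (f ⁻¹' {i}) = d Set.univ := fun d => by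
      simpa using tsum_measure_inter_preimage_singleton d hf .univ
    obtain ⟨q, hrow, hcol, hcost⟩ := exists_remove_common c
      (fun i j k => ofReal_dist_rpow_triangle hp0 hp1 _ _ _) (fun _ _ => ENNReal.ofReal_ne_top)
      (fun i => a (f ⁻¹' {i})) (fun i => b (f ⁻¹' {i})) (fun i => s (f ⁻¹' {i}))
      (by simp [hsum]) (by simp [hsum]) (by simp [hsum]) (fun i j => m {(i, j)})
      (fun i => by
        rw [tsum_measure_singleton_prod, hm₁, Measure.map_apply hf (measurableSet_singleton i),
          Measure.add_apply])
      (fun j => by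
        rw [tsum_measure_prod_singleton, hm₂, Measure.map_apply hf (measurableSet_singleton j),
          Measure.add_apply])
    obtain ⟨γ', hγ', hint⟩ := exists_coupling_of_matrix a b hf q hrow hcol
    have hm : ∑' i, ∑' j, c i j * m {(i, j)} ≤
        transportCost p γ + 2 * η * (a + s) Set.univ := by
      calc ∑' i, ∑' j, c i j * m {(i, j)} = ∫⁻ z, c (f z.1) (f z.2) ∂γ := by
            rw [← ENNReal.tsum_prod' (f := fun z => c z.1 z.2 * m {z}),
              ← lintegral_countable' (fun z : ℕ × ℕ => c z.1 z.2),
              lintegral_map (measurable_of_countable _) hF]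
            rfl
        _ ≤ ∫⁻ z, (ENNReal.ofReal (dist z.1 z.2 ^ p) + 2 * η) ∂γ :=
            lintegral_mono fun z => hge z.1 z.2
        _ = _ := by
            rw [lintegral_add_right _ measurable_const, lintegral_const, hmass]; rfl
    calc W p a b ≤ transportCost p γ' := iInf₂_le γ' hγ'
      _ ≤ ∑' i, ∑' j, (c i j + 2 * η) * q i j := hint _ (fun i j => c i j + 2 * η) hle
      _ = ∑' i, ∑' j, c i j * q i j + 2 * η * a Set.univ := by
          simp only [add_mul, ENNReal.tsum_add, ENNReal.tsum_mul_left, hrow, hsum]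
      _ ≤ transportCost p γ + 2 * η * (a + s) Set.univ + 2 * η * a Set.univ := by
          gcongr; exact hcost.trans hm
      _ = _ := by ring
  have hlim : Tendsto (fun δ : ℝ => transportCost p γ +
      2 * ENNReal.ofReal (δ ^ p) * ((a + s) Set.univ + a Set.univ)) (𝓝[>] 0)
      (𝓝 (transportCost p γ + 2 * ENNReal.ofReal ((0 : ℝ) ^ p) *
        ((a + s) Set.univ + a Set.univ))) := by
    refine Tendsto.mono_left (Tendsto.const_add _ (ENNReal.Tendsto.mul_const
      (ENNReal.Tendsto.const_mul ?_ (Or.inr (by simp)))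
      (Or.inr (by simp [measure_ne_top])))) nhdsWithin_le_nhds
    exact (ENNReal.continuous_ofReal.comp (Real.continuous_rpow_const hp0.le)).tendsto 0
  rw [Real.zero_rpow hp0.ne', ENNReal.ofReal_zero, mul_zero, zero_mul, add_zero] at hlim
  exact ge_of_tendsto hlim (eventually_mem_nhdsWithin.mono bound)

instance (μ : SignedMeasure X) : IsFiniteMeasure (pos μ) :=
  inferInstanceAs (IsFiniteMeasure μ.toJordanDecomposition.posPart)

instance (μ : SignedMeasure X) : IsFiniteMeasure (neg μ) :=
  inferInstanceAs (IsFiniteMeasure μ.toJordanDecomposition.negPart)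

lemma toSignedMeasure_pos_sub_neg (μ : SignedMeasure X) :
    (pos μ).toSignedMeasure - (neg μ).toSignedMeasure = μ :=
  μ.toSignedMeasure_toJordanDecomposition

/-- Any representation of a signed measure as a difference of finite measures exceeds the Jordan
decomposition by a common measure. -/
lemma exists_eq_pos_add_and_eq_neg_add (P N : Measure X) [IsFiniteMeasure P] [IsFiniteMeasure N]
    {μ : SignedMeasure X} (h : P.toSignedMeasure - N.toSignedMeasure = μ) :
    ∃ s : Measure X, IsFiniteMeasure s ∧ P = pos μ + s ∧ N = neg μ + s := by
  have hpos : pos μ = P - N := by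
    rw [pos, ← h, Measure.toJordanDecomposition_toSignedMeasure_sub]; rfl
  have hle : pos μ ≤ P := hpos ▸ Measure.sub_le
  have hP : P = pos μ + (P - pos μ) := by rw [add_comm, Measure.sub_add_cancel_of_le hle]
  refine ⟨P - pos μ, inferInstance, hP, ?_⟩
  rw [← Measure.toSignedMeasure_eq_toSignedMeasure_iff, Measure.toSignedMeasure_add]
  have hP' : (pos μ).toSignedMeasure + (P - pos μ).toSignedMeasure = P.toSignedMeasure := by
    rw [← Measure.toSignedMeasure_add]; exact (Measure.toSignedMeasure_congr hP).symm
  calc N.toSignedMeasure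
      = P.toSignedMeasure - (P.toSignedMeasure - N.toSignedMeasure) := (_root_.sub_sub_cancel _ _).symm
    _ = (pos μ).toSignedMeasure + (P - pos μ).toSignedMeasure -
          ((pos μ).toSignedMeasure - (neg μ).toSignedMeasure) := by
        rw [h, hP', toSignedMeasure_pos_sub_neg]
    _ = (neg μ).toSignedMeasure + (P - pos μ).toSignedMeasure := by
        rw [add_sub_sub_cancel, add_comm]

lemma add_mem_couplings {a b a' b' : Measure X} {γ γ' : Measure (X × X)} (h : γ ∈ couplings a b)
    (h' : γ' ∈ couplings a' b') : γ + γ' ∈ couplings (a + a') (b + b') :=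
  ⟨by rw [Measure.map_add _ _ measurable_fst, h.1, h'.1],
    by rw [Measure.map_add _ _ measurable_snd, h.2, h'.2]⟩

end Coupling

/-- triangle inequality for the Wasserstein cost of balanced measures. -/
theorem wasserstein_cost_triangle {n : ℕ} (Ω : Set (EuclideanSpace ℝ (Fin n))) (p : ℝ)
    (hp0 : 0 < p) (hp1 : p ≤ 1) (μ ν : SignedMeasure ↥Ω)
    (hμ : μ Set.univ = 0) (hν : ν Set.univ = 0) :
    W p (pos (ν + μ)) (neg (ν + μ)) ≤ W p (pos ν) (neg ν) + W p (pos μ) (neg μ) := by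
  obtain ⟨s, hs, hP, hN⟩ := exists_eq_pos_add_and_eq_neg_add (pos ν + pos μ) (neg ν + neg μ)
    (μ := ν + μ) (by
      rw [Measure.toSignedMeasure_add, Measure.toSignedMeasure_add, add_sub_add_comm,
        toSignedMeasure_pos_sub_neg, toSignedMeasure_pos_sub_neg])
  conv_rhs => simp only [W, ENNReal.iInf_add, ENNReal.add_iInf]
  refine le_iInf₂ fun γ₁ h₁ => le_iInf₂ fun γ₂ h₂ => ?_
  have hγ := add_mem_couplings h₂ h₁
  rw [hP, hN] at hγ
  refine (W_le_transportCost_of_mem_couplings_add hp0 hp1 _ _ s hγ).trans_eq ?_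
  exact lintegral_add_measure _ _ _
end

section
/- Let Ω ⊆ ℝⁿ be convex, p ∈ (0,1], α > 0 and β > 0. Then for every μ ∈ M(Ω) the infimal convolution defining ‖μ‖_{KR_p^{α,β}} is exact: there exists a balanced measure ν̄ ∈ M(Ω) with ν̄(Ω) = 0 such that ‖μ‖_{KR_p^{α,β}} = W_p(ν̄⁺, ν̄⁻) + (β/2)|ν̄|(Ω) + α|μ − ν̄|(Ω). -/
open MeasureTheory ENNReal

open Set Filter Topology
open scoped NNReal BoundedContinuousFunction

namespace MeasureTheory.Measure

variable {X Y : Type*} [MeasurableSpace X] [MeasurableSpace Y]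

lemma exists_le_one_withDensity_eq {ρ σ : Measure X} [SigmaFinite ρ] [SigmaFinite σ]
    (h : ρ ≤ σ) : ∃ f : X → ℝ≥0∞, Measurable f ∧ (∀ x, f x ≤ 1) ∧ σ.withDensity f = ρ := by
  refine ⟨fun x => min (ρ.rnDeriv σ x) 1, (measurable_rnDeriv ρ σ).min measurable_const,
    fun x => min_le_right _ _, ?_⟩
  rw [← withDensity_rnDeriv_eq ρ σ (absolutelyContinuous_of_le h)]
  refine withDensity_congr_ae ?_
  rw [withDensity_rnDeriv_eq ρ σ (absolutelyContinuous_of_le h)]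
  filter_upwards [rnDeriv_le_one_of_le h] with x hx
  exact min_eq_left hx

lemma withDensity_le_self {σ : Measure X} {f : X → ℝ≥0∞} (hf : ∀ x, f x ≤ 1) :
    σ.withDensity f ≤ σ :=
  (withDensity_mono (ae_of_all _ hf)).trans_eq (withDensity_one (μ := σ))

lemma exists_map_eq_of_le_map {j : X → Y} (hj : Measurable j) {σ : Measure X} [IsFiniteMeasure σ]
    {ρ : Measure Y} [IsFiniteMeasure ρ] (h : ρ ≤ σ.map j) : ∃ τ ≤ σ, τ.map j = ρ := by
  obtain ⟨f, hf, hf1, rfl⟩ := exists_le_one_withDensity_eq h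
  refine ⟨σ.withDensity (f ∘ j), withDensity_le_self fun x => hf1 (j x), ?_⟩
  ext s hs
  rw [map_apply hj hs, withDensity_apply _ (hj hs), withDensity_apply _ hs,
    setLIntegral_map hs hf hj]
  rfl

end MeasureTheory.Measure

namespace MeasureTheory

variable {X : Type*} [MeasurableSpace X]

instance (μ : SignedMeasure X) : IsFiniteMeasure (pos μ) := by unfold pos; infer_instance

instance (μ : SignedMeasure X) : IsFiniteMeasure (neg μ) := by unfold neg; infer_instance

lemma pos_neg_eq (μ : SignedMeasure X) : pos (-μ) = neg μ := by
  simp [pos, neg, SignedMeasure.toJordanDecomposition_neg]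

lemma tv_eq (μ : SignedMeasure X) : tv μ = pos μ univ + neg μ univ := rfl

lemma apply_eq_pos_sub_neg (μ : SignedMeasure X) {s : Set X} (hs : MeasurableSet s) :
    μ s = (pos μ).real s - (neg μ).real s :=
  μ.apply_eq_posPart_real_sub_negPart_real hs

lemma toSignedMeasure_pos_sub_neg (μ : SignedMeasure X) :
    (pos μ).toSignedMeasure - (neg μ).toSignedMeasure = μ :=
  μ.toSignedMeasure_toJordanDecomposition

lemma pos_restrict_le {μ ν : SignedMeasure X} {s : Set X} (hs : MeasurableSet s)
    (h : ∀ t, MeasurableSet t → t ⊆ s → ν t ≤ μ t) :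
    (pos ν).restrict s ≤ (pos μ).restrict s := by
  obtain ⟨S, hS, hpos, hneg⟩ : pos ν ⟂ₘ neg ν := ν.toJordanDecomposition.mutuallySingular
  refine Measure.le_iff.2 fun t ht => ?_
  rw [Measure.restrict_apply ht, Measure.restrict_apply ht]
  have hm : MeasurableSet ((t ∩ s) ∩ Sᶜ) := (ht.inter hs).inter hS.compl
  have hle := h _ hm (inter_subset_left.trans inter_subset_right)
  rw [apply_eq_pos_sub_neg _ hm, apply_eq_pos_sub_neg _ hm] at hle
  have h0 : (neg ν).real ((t ∩ s) ∩ Sᶜ) = 0 := by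
    rw [measureReal_def, measure_mono_null inter_subset_right hneg, ENNReal.toReal_zero]
  have hle' : (pos ν).real ((t ∩ s) ∩ Sᶜ) ≤ (pos μ).real ((t ∩ s) ∩ Sᶜ) := by
    have : 0 ≤ (neg μ).real ((t ∩ s) ∩ Sᶜ) := measureReal_nonneg
    linarith
  calc pos ν (t ∩ s) ≤ pos ν ((t ∩ s) ∩ S) + pos ν ((t ∩ s) ∩ Sᶜ) := by
        rw [← sdiff_eq, measure_inter_add_sdiff _ hS]
    _ = pos ν ((t ∩ s) ∩ Sᶜ) := by rw [measure_mono_null inter_subset_right hpos, zero_add]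
    _ ≤ pos μ ((t ∩ s) ∩ Sᶜ) :=
        (ENNReal.toReal_le_toReal (measure_ne_top _ _) (measure_ne_top _ _)).1 hle'
    _ ≤ pos μ (t ∩ s) := measure_mono inter_subset_left

lemma neg_restrict_le {μ ν : SignedMeasure X} {s : Set X} (hs : MeasurableSet s)
    (h : ∀ t, MeasurableSet t → t ⊆ s → ν t ≤ μ t) :
    (neg μ).restrict s ≤ (neg ν).restrict s := by
  rw [← pos_neg_eq, ← pos_neg_eq]
  exact pos_restrict_le hs fun t ht hts => by simpa using h t ht hts

lemma restrict_add_restrict_compl_le {ρ σ τ : Measure X} {s : Set X} (hs : MeasurableSet s)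
    (h₁ : ρ.restrict s ≤ τ.restrict s) (h₂ : σ.restrict sᶜ ≤ τ.restrict sᶜ) :
    ρ.restrict s + σ.restrict sᶜ ≤ τ :=
  (add_le_add h₁ h₂).trans_eq (Measure.restrict_add_restrict_compl hs)

/-- The common part of two signed measures: positive and negative parts in common account for the
whole loss in the triangle inequality for `μ - ν`. -/
lemma exists_common_part (μ ν : SignedMeasure X) :
    ∃ ρ σ : Measure X, ρ ≤ pos μ ∧ ρ ≤ pos ν ∧ σ ≤ neg μ ∧ σ ≤ neg ν ∧
      tv μ + tv ν ≤ tv (μ - ν) + 2 * (ρ univ + σ univ) := by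
  obtain ⟨s, hs, hpos, hneg⟩ := (μ - ν).exists_compl_positive_negative
  rw [VectorMeasure.restrict_le_restrict_iff _ _ hs] at hpos
  rw [VectorMeasure.restrict_le_restrict_iff _ _ hs.compl] at hneg
  have h₁ : ∀ t, MeasurableSet t → t ⊆ s → ν t ≤ μ t := fun t ht hts => by
    simpa using hpos ht hts
  have h₂ : ∀ t, MeasurableSet t → t ⊆ sᶜ → μ t ≤ ν t := fun t ht hts => by
    simpa using hneg ht hts
  refine ⟨(pos ν).restrict s + (pos μ).restrict sᶜ, (neg μ).restrict s + (neg ν).restrict sᶜ,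
    restrict_add_restrict_compl_le hs (pos_restrict_le hs h₁) le_rfl,
    restrict_add_restrict_compl_le hs le_rfl (pos_restrict_le hs.compl h₂),
    restrict_add_restrict_compl_le hs le_rfl (neg_restrict_le hs.compl h₂),
    restrict_add_restrict_compl_le hs (neg_restrict_le hs h₁) le_rfl, ?_⟩
  have e₁ := apply_eq_pos_sub_neg (μ - ν) hs
  have e₂ := apply_eq_pos_sub_neg (μ - ν) hs.compl
  rw [sub_apply, apply_eq_pos_sub_neg _ hs, apply_eq_pos_sub_neg _ hs] at e₁
  rw [sub_apply, apply_eq_pos_sub_neg _ hs.compl,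
    apply_eq_pos_sub_neg _ hs.compl] at e₂
  have split : ∀ ρ : Measure X, ρ univ = ρ s + ρ sᶜ := fun ρ => (measure_add_measure_compl hs).symm
  simp only [tv_eq, split, Measure.add_apply, Measure.restrict_apply hs,
    Measure.restrict_apply hs.compl, inter_self, two_mul, inter_compl_self,
    compl_inter_self, measure_empty, add_zero, zero_add]
  rw [← ENNReal.toReal_le_toReal (by finiteness) (by finiteness)]
  have hnn₁ : 0 ≤ (neg (μ - ν)).real s := measureReal_nonneg
  have hnn₂ : 0 ≤ (pos (μ - ν)).real sᶜ := measureReal_nonneg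
  simp only [measureReal_def] at e₁ e₂ hnn₁ hnn₂
  simp only [ENNReal.toReal_add, ENNReal.add_ne_top,
    measure_ne_top, ne_eq, not_false_eq_true, and_self]
  linarith

lemma pos_toSignedMeasure_sub {ρ σ : Measure X} [IsFiniteMeasure ρ] [IsFiniteMeasure σ]
    (h : ρ ⟂ₘ σ) : pos (ρ.toSignedMeasure - σ.toSignedMeasure) = ρ :=
  congrArg JordanDecomposition.posPart
    (SignedMeasure.toJordanDecomposition_eq (j := ⟨ρ, σ, h⟩) rfl)

lemma neg_toSignedMeasure_sub {ρ σ : Measure X} [IsFiniteMeasure ρ] [IsFiniteMeasure σ]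
    (h : ρ ⟂ₘ σ) : neg (ρ.toSignedMeasure - σ.toSignedMeasure) = σ :=
  congrArg JordanDecomposition.negPart
    (SignedMeasure.toJordanDecomposition_eq (j := ⟨ρ, σ, h⟩) rfl)

lemma tv_toSignedMeasure_sub_le (ρ σ : Measure X) [IsFiniteMeasure ρ] [IsFiniteMeasure σ] :
    tv (ρ.toSignedMeasure - σ.toSignedMeasure) ≤ ρ univ + σ univ := by
  simp only [tv_eq, pos, neg, Measure.toJordanDecomposition_toSignedMeasure_sub]
  exact add_le_add (Measure.sub_le univ) (Measure.sub_le univ)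

lemma tv_sub_le (μ : SignedMeasure X) {ρ σ : Measure X} [IsFiniteMeasure ρ] [IsFiniteMeasure σ]
    (hρ : ρ ≤ pos μ) (hσ : σ ≤ neg μ) :
    tv (μ - (ρ.toSignedMeasure - σ.toSignedMeasure)) ≤
      (pos μ univ - ρ univ) + (neg μ univ - σ univ) := by
  have key : μ - (ρ.toSignedMeasure - σ.toSignedMeasure) =
      (pos μ - ρ).toSignedMeasure - (neg μ - σ).toSignedMeasure := by
    nth_rw 1 [← toSignedMeasure_pos_sub_neg μ]
    have h₁ : (pos μ).toSignedMeasure = (pos μ - ρ).toSignedMeasure + ρ.toSignedMeasure := by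
      rw [← Measure.toSignedMeasure_add]
      exact Measure.toSignedMeasure_congr (Measure.sub_add_cancel_of_le hρ).symm
    have h₂ : (neg μ).toSignedMeasure = (neg μ - σ).toSignedMeasure + σ.toSignedMeasure := by
      rw [← Measure.toSignedMeasure_add]
      exact Measure.toSignedMeasure_congr (Measure.sub_add_cancel_of_le hσ).symm
    rw [h₁, h₂]
    abel
  rw [key, ← Measure.sub_apply .univ hρ, ← Measure.sub_apply .univ hσ]
  exact tv_toSignedMeasure_sub_le _ _

end MeasureTheory

/-- The cost of a partial transport plan `γ` between `ρ` and `σ`: the transport cost, plus `β` per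
unit of transported mass, plus `α` per unit of mass left in place. -/
noncomputable def subplanCost {X : Type*} [MeasurableSpace X] [PseudoMetricSpace X] (p α β : ℝ)
    (ρ σ : Measure X) (γ : Measure (X × X)) : ℝ≥0∞ :=
  transportCost p γ + ENNReal.ofReal (β / 2) * (γ univ + γ univ) +
    ENNReal.ofReal α * ((ρ univ - γ univ) + (σ univ - γ univ))

namespace MeasureTheory

lemma add_le_mul_add_one {a b : ℝ≥0∞} (ha : a ≤ 1) (hb : b ≤ 1) : a + b ≤ a * b + 1 := by
  lift a to ℝ≥0 using ne_top_of_le_ne_top ENNReal.one_ne_top ha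
  lift b to ℝ≥0 using ne_top_of_le_ne_top ENNReal.one_ne_top hb
  norm_cast at *
  rw [← NNReal.coe_le_coe] at *
  push_cast at *
  nlinarith

variable {X : Type*} [MeasurableSpace X]

lemma exists_subplan_of_le {ρ σ ρ' σ' : Measure X} [IsFiniteMeasure ρ] [IsFiniteMeasure σ]
    {γ : Measure (X × X)} (hγ : γ ∈ couplings ρ σ) (hρ : ρ' ≤ ρ) (hσ : σ' ≤ σ) :
    ∃ γ' ≤ γ, γ'.map Prod.fst ≤ ρ' ∧ γ'.map Prod.snd ≤ σ' ∧
      ρ' univ + σ' univ ≤ γ' univ + γ univ := by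
  have : IsFiniteMeasure ρ' := isFiniteMeasure_of_le ρ hρ
  have : IsFiniteMeasure σ' := isFiniteMeasure_of_le σ hσ
  obtain ⟨f, hf, hf1, rfl⟩ := Measure.exists_le_one_withDensity_eq hρ
  obtain ⟨g, hg, hg1, rfl⟩ := Measure.exists_le_one_withDensity_eq hσ
  obtain ⟨rfl, rfl⟩ := hγ
  have hfm : Measurable fun z : X × X => f z.1 := hf.comp measurable_fst
  have hgm : Measurable fun z : X × X => g z.2 := hg.comp measurable_snd
  have hfgm : Measurable fun z : X × X => f z.1 * g z.2 := hfm.mul hgm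
  refine ⟨γ.withDensity fun z => f z.1 * g z.2,
    Measure.withDensity_le_self fun z => mul_le_one' (hf1 _) (hg1 _), ?_, ?_, ?_⟩
  · refine Measure.le_iff.2 fun s hs => ?_
    rw [Measure.map_apply measurable_fst hs, withDensity_apply _ (measurable_fst hs),
      withDensity_apply _ hs, setLIntegral_map hs hf measurable_fst]
    exact lintegral_mono fun z => mul_le_of_le_one_right' (hg1 _)
  · refine Measure.le_iff.2 fun s hs => ?_
    rw [Measure.map_apply measurable_snd hs, withDensity_apply _ (measurable_snd hs),
      withDensity_apply _ hs, setLIntegral_map hs hg measurable_snd]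
    exact lintegral_mono fun z => mul_le_of_le_one_left' (hf1 _)
  · rw [withDensity_apply _ .univ, withDensity_apply _ .univ, withDensity_apply _ .univ,
      setLIntegral_univ, setLIntegral_univ, setLIntegral_univ, lintegral_map hf measurable_fst,
      lintegral_map hg measurable_snd, ← lintegral_add_left hfm, ← setLIntegral_one univ,
      setLIntegral_univ, ← lintegral_add_left hfgm]
    exact lintegral_mono fun z => add_le_mul_add_one (hf1 _) (hg1 _)

variable [PseudoMetricSpace X]

lemma transportCost_mono (p : ℝ) {γ γ' : Measure (X × X)} (h : γ' ≤ γ) :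
    transportCost p γ' ≤ transportCost p γ :=
  lintegral_mono' h le_rfl

lemma exists_subplanCost_le (p α β : ℝ) (μ ν : SignedMeasure X) {γ : Measure (X × X)}
    (hγ : γ ∈ couplings (pos ν) (neg ν)) :
    ∃ γ' : Measure (X × X), γ'.map Prod.fst ≤ pos μ ∧ γ'.map Prod.snd ≤ neg μ ∧
      subplanCost p α β (pos μ) (neg μ) γ' ≤
        transportCost p γ + ENNReal.ofReal (β / 2) * tv ν + ENNReal.ofReal α * tv (μ - ν) := by
  obtain ⟨ρ, σ, hρμ, hρν, hσμ, hσν, h⟩ := exists_common_part μ ν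
  obtain ⟨γ', hle, h₁, h₂, hmass⟩ := exists_subplan_of_le hγ hρν hσν
  refine ⟨γ', h₁.trans hρμ, h₂.trans hσμ, ?_⟩
  have e₁ : pos ν univ = γ univ := by rw [← hγ.1, Measure.map_apply measurable_fst .univ]; rfl
  have e₂ : neg ν univ = γ univ := by rw [← hγ.2, Measure.map_apply measurable_snd .univ]; rfl
  have hfin : γ univ ≠ ∞ := e₁ ▸ measure_ne_top _ _
  have f₁ : γ' univ ≤ pos μ univ := by
    simpa [Measure.map_apply measurable_fst .univ] using (h₁.trans hρμ) univ
  have f₂ : γ' univ ≤ neg μ univ := by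
    simpa [Measure.map_apply measurable_snd .univ] using (h₂.trans hσμ) univ
  have hle' : γ' univ ≤ γ univ := hle univ
  have hfin' : γ' univ ≠ ∞ := ne_top_of_le_ne_top hfin hle'
  have hfin'' : tv (μ - ν) ≠ ∞ := by rw [tv_eq]; finiteness
  unfold subplanCost
  gcongr ?_ + _ * ?_ + _ * ?_
  · exact transportCost_mono p hle
  · rw [tv_eq, e₁, e₂]
    gcongr
  · have f₃ : (pos μ univ - γ' univ) + (neg μ univ - γ' univ) + (γ' univ + γ' univ) = tv μ := by
      rw [add_add_add_comm, tsub_add_cancel_of_le f₁, tsub_add_cancel_of_le f₂, tv_eq]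
    rw [← ENNReal.add_le_add_iff_right (a := γ' univ + γ' univ) (by finiteness), f₃]
    have h' : tv μ + (γ univ + γ univ) ≤
        tv (μ - ν) + (γ' univ + γ' univ) + (γ univ + γ univ) := by
      calc tv μ + (γ univ + γ univ) = tv μ + tv ν := by rw [tv_eq ν, e₁, e₂]
        _ ≤ tv (μ - ν) + 2 * (ρ univ + σ univ) := h
        _ ≤ tv (μ - ν) + 2 * (γ' univ + γ univ) := by gcongr
        _ = _ := by ring
    exact (ENNReal.add_le_add_iff_right (by finiteness)).1 h'

lemma cost_toSignedMeasure_sub_le (p α β : ℝ) (μ : SignedMeasure X) {ρ σ : Measure X}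
    [IsFiniteMeasure ρ] [IsFiniteMeasure σ] (hρ : ρ ≤ pos μ) (hσ : σ ≤ neg μ)
    (h : ρ univ = σ univ) :
    W p (pos (ρ.toSignedMeasure - σ.toSignedMeasure)) (neg (ρ.toSignedMeasure - σ.toSignedMeasure))
        + ENNReal.ofReal (β / 2) * tv (ρ.toSignedMeasure - σ.toSignedMeasure)
        + ENNReal.ofReal α * tv (μ - (ρ.toSignedMeasure - σ.toSignedMeasure)) ≤
      W p ρ σ + ENNReal.ofReal (β / 2) * (ρ univ + ρ univ) +
        ENNReal.ofReal α * ((pos μ univ - ρ univ) + (neg μ univ - ρ univ)) := by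
  have hs : ρ ⟂ₘ σ := μ.toJordanDecomposition.mutuallySingular.mono hρ hσ
  rw [tv_eq (ρ.toSignedMeasure - σ.toSignedMeasure), pos_toSignedMeasure_sub hs,
    neg_toSignedMeasure_sub hs, ← h]
  gcongr
  exact (tv_sub_le μ hρ hσ).trans_eq (by rw [h])

end MeasureTheory

namespace MeasureTheory

section Coupling

variable {X : Type*} [MeasurableSpace X]

/-- Given a coupling `κ` of the pushforwards of `ρ` and `σ` to a countable space, the density with
respect to `ρ × σ` of a coupling of `ρ` and `σ` inducing `κ`. -/
noncomputable def gluingDensity {ι : Type*} [MeasurableSpace ι] (κ : Measure (ι × ι)) (a b : Measure ι)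
    (k l : ι) : ℝ≥0∞ :=
  κ {(k, l)} / (a {k} * b {l})

variable {ι : Type*} [MeasurableSpace ι] [MeasurableSingletonClass ι]

lemma gluingDensity_mul {κ : Measure (ι × ι)} {a b : Measure ι} [IsFiniteMeasure a]
    [IsFiniteMeasure b] (hκ : κ ∈ couplings a b) (k l : ι) :
    gluingDensity κ a b k l * (a {k} * b {l}) = κ {(k, l)} := by
  obtain ⟨rfl, rfl⟩ := hκ
  by_cases h : κ.map Prod.fst {k} * κ.map Prod.snd {l} = 0
  · rw [h, mul_zero]
    rw [mul_eq_zero, Measure.map_apply measurable_fst (.singleton k),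
      Measure.map_apply measurable_snd (.singleton l)] at h
    rcases h with h | h
    · exact (measure_mono_null (by rintro _ rfl; rfl) h).symm
    · exact (measure_mono_null (by rintro _ rfl; rfl) h).symm
  · exact ENNReal.div_mul_cancel h (by finiteness)

variable [Countable ι]

lemma tsum_gluingDensity_mul_snd {κ : Measure (ι × ι)} {a b : Measure ι} [IsFiniteMeasure a]
    [IsFiniteMeasure b] (hκ : κ ∈ couplings a b) {k : ι} (hk : a {k} ≠ 0) :
    ∑' l, gluingDensity κ a b k l * b {l} = 1 := by
  have h : ∑' l, gluingDensity κ a b k l * b {l} * a {k} = a {k} := by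
    simp_rw [mul_assoc, mul_comm (b _), gluingDensity_mul hκ]
    rw [← hκ.1]
    rw [Measure.map_apply measurable_fst (.singleton k)]
    have : Prod.fst ⁻¹' {k} = ⋃ l : ι, {((k, l) : ι × ι)} := by ext ⟨x, y⟩; simp [eq_comm]
    rw [this, measure_iUnion _ fun l => .singleton _]
    intro l l' hl
    simpa [Function.onFun] using hl
  rw [ENNReal.tsum_mul_right] at h
  exact (ENNReal.mul_eq_right hk (by finiteness)).1 h

lemma tsum_gluingDensity_mul_fst {κ : Measure (ι × ι)} {a b : Measure ι} [IsFiniteMeasure a]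
    [IsFiniteMeasure b] (hκ : κ ∈ couplings a b) {l : ι} (hl : b {l} ≠ 0) :
    ∑' k, gluingDensity κ a b k l * a {k} = 1 := by
  have h : ∑' k, gluingDensity κ a b k l * a {k} * b {l} = b {l} := by
    simp_rw [mul_assoc, gluingDensity_mul hκ]
    rw [← hκ.2]
    rw [Measure.map_apply measurable_snd (.singleton l)]
    have : Prod.snd ⁻¹' {l} = ⋃ k : ι, {((k, l) : ι × ι)} := by ext ⟨x, y⟩; simp [eq_comm]
    rw [this, measure_iUnion _ fun k => .singleton _]
    intro k k' hk
    simpa [Function.onFun] using hk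
  rw [ENNReal.tsum_mul_right] at h
  exact (ENNReal.mul_eq_right hl (by finiteness)).1 h

/-- A coupling of discretizations of `ρ` and `σ` lifts to a coupling of `ρ` and `σ`. -/
lemma exists_coupling_map_prodMap_eq {ρ σ : Measure X} [IsFiniteMeasure ρ] [IsFiniteMeasure σ]
    {f : X → ι} (hf : Measurable f) {κ : Measure (ι × ι)}
    (hκ : κ ∈ couplings (ρ.map f) (σ.map f)) :
    ∃ γ ∈ couplings ρ σ, γ.map (Prod.map f f) = κ := by
  set a := ρ.map f
  set b := σ.map f
  set d : ι × ι → ℝ≥0∞ := fun z => gluingDensity κ a b z.1 z.2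
  have hd : Measurable d := measurable_of_countable d
  have hff : Measurable (Prod.map f f) := hf.prodMap hf
  have hne : ∀ τ : Measure X, ∀ᵐ x ∂τ, τ.map f {f x} ≠ 0 := fun τ => by
    refine ae_of_ae_map hf.aemeasurable (p := fun k => τ.map f {k} ≠ 0) ?_
    rw [ae_iff_of_countable]
    exact fun k hk => hk
  have hdf : Measurable fun z : X × X => d (f z.1, f z.2) := hd.comp hff
  refine ⟨(ρ.prod σ).withDensity fun z => d (f z.1, f z.2), ⟨?_, ?_⟩, ?_⟩
  · ext s hs
    rw [Measure.map_apply measurable_fst hs, withDensity_apply _ (measurable_fst hs),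
      ← prod_univ, setLIntegral_prod _ hdf.aemeasurable, Measure.restrict_univ]
    rw [← setLIntegral_one]
    refine lintegral_congr_ae (ae_restrict_of_ae ?_)
    filter_upwards [hne ρ] with x hx
    rw [← tsum_gluingDensity_mul_snd hκ hx, ← lintegral_countable',
      lintegral_map (measurable_of_countable _) hf]
  · ext s hs
    rw [Measure.map_apply measurable_snd hs, withDensity_apply _ (measurable_snd hs),
      ← univ_prod, setLIntegral_prod_symm _ hdf.aemeasurable, Measure.restrict_univ]
    rw [← setLIntegral_one]
    refine lintegral_congr_ae (ae_restrict_of_ae ?_)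
    filter_upwards [hne σ] with y hy
    rw [← tsum_gluingDensity_mul_fst hκ hy, ← lintegral_countable',
      lintegral_map (measurable_of_countable _) hf]
  · refine Measure.ext_of_singleton fun ⟨k, l⟩ => ?_
    have hpre : Prod.map f f ⁻¹' {(k, l)} = (f ⁻¹' {k}) ×ˢ (f ⁻¹' {l}) := by ext; simp [Prod.ext_iff]
    rw [Measure.map_apply hff (.singleton _), withDensity_apply _ (hff (.singleton _)),
      setLIntegral_congr_fun (g := fun _ => d (k, l)) (hff (.singleton _)), setLIntegral_const,
      hpre, Measure.prod_prod, ← gluingDensity_mul hκ, Measure.map_apply hf (.singleton _),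
      Measure.map_apply hf (.singleton _)]
    rintro ⟨x, y⟩ hz
    obtain ⟨rfl, rfl⟩ : f x = k ∧ f y = l := by simpa using hz
    rfl

end Coupling

lemma exists_measurable_index {E : Type*} [MeasurableSpace E] [PseudoMetricSpace E]
    [OpensMeasurableSpace E] [TopologicalSpace.SeparableSpace E] {ε : ℝ} (hε : 0 < ε) :
    ∃ f : E → ℕ, Measurable f ∧ ∀ x y, f x = f y → dist x y ≤ ε := by
  classical
  rcases isEmpty_or_nonempty E with h | h
  · exact ⟨fun _ => 0, measurable_const, fun x => (IsEmpty.false x).elim⟩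
  have hex : ∀ x : E, ∃ k, dist x (TopologicalSpace.denseSeq E k) < ε / 2 := fun x => by
    obtain ⟨k, hk⟩ := (TopologicalSpace.denseRange_denseSeq E).exists_dist_lt x (half_pos hε)
    exact ⟨k, hk⟩
  refine ⟨fun x => Nat.find (hex x), measurable_find hex fun k => ?_, fun x y hxy => ?_⟩
  · exact Metric.isOpen_ball.measurableSet
  · have hx := Nat.find_spec (hex x)
    have hy := Nat.find_spec (hex y)
    dsimp only at hxy
    rw [← hxy] at hy
    linarith [dist_triangle_right x y (TopologicalSpace.denseSeq E (Nat.find (hex x)))]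

variable {X E : Type*} [MeasurableSpace X] [PseudoMetricSpace X] [MeasurableSpace E]
  [PseudoMetricSpace E]

lemma W_le_transportCost_add [OpensMeasurableSpace E] [SecondCountableTopology E] {p : ℝ}
    (hp0 : 0 < p) (hp1 : p ≤ 1) {j : X → E} (hj : Measurable j) (hiso : Isometry j)
    {ρ σ : Measure X} [IsFiniteMeasure ρ] [IsFiniteMeasure σ] {γ : Measure (E × E)}
    (hγ : γ ∈ couplings (ρ.map j) (σ.map j)) {ε : ℝ} (hε : 0 < ε) :
    W p ρ σ ≤ transportCost p γ + ENNReal.ofReal ((ε + ε) ^ p) * γ univ := by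
  obtain ⟨f, hf, hfε⟩ := exists_measurable_index (E := E) hε
  have hff : Measurable (Prod.map f f) := hf.prodMap hf
  have hfj : Measurable (f ∘ j) := hf.comp hj
  have hfjfj : Measurable (Prod.map (f ∘ j) (f ∘ j)) := hfj.prodMap hfj
  have hκ : γ.map (Prod.map f f) ∈ couplings (ρ.map (f ∘ j)) (σ.map (f ∘ j)) := by
    rw [← Measure.map_map hf hj, ← Measure.map_map hf hj, ← hγ.1, ← hγ.2]
    constructor
    · rw [Measure.map_map measurable_fst hff, Measure.map_map hf measurable_fst]; rfl
    · rw [Measure.map_map measurable_snd hff, Measure.map_map hf measurable_snd]; rfl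
  obtain ⟨γ', hγ', hmap⟩ := exists_coupling_map_prodMap_eq hfj hκ
  set D : ℕ × ℕ → ℝ≥0∞ := fun k =>
    ⨆ (z : E × E) (_ : Prod.map f f z = k), ENNReal.ofReal (dist z.1 z.2 ^ p)
  have hD : Measurable D := measurable_of_countable D
  calc W p ρ σ ≤ transportCost p γ' := iInf₂_le γ' hγ'
    _ ≤ ∫⁻ z, D (Prod.map (f ∘ j) (f ∘ j) z) ∂γ' := by
        refine lintegral_mono fun z => ?_
        rw [← hiso.dist_eq]
        exact le_iSup₂ (f := fun (w : E × E) (_ : Prod.map f f w = Prod.map (f ∘ j) (f ∘ j) z) =>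
          ENNReal.ofReal (dist w.1 w.2 ^ p)) (j z.1, j z.2) rfl
    _ = ∫⁻ z, D (Prod.map f f z) ∂γ := by
        rw [← lintegral_map hD hfjfj, hmap, lintegral_map hD hff]
    _ ≤ ∫⁻ z, (ENNReal.ofReal (dist z.1 z.2 ^ p) + ENNReal.ofReal ((ε + ε) ^ p)) ∂γ := by
        refine lintegral_mono fun z => iSup₂_le fun w hw => ?_
        obtain ⟨h₁, h₂⟩ : f w.1 = f z.1 ∧ f w.2 = f z.2 := by simpa [Prod.ext_iff] using hw
        rw [← ENNReal.ofReal_add (by positivity) (by positivity)]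
        refine ENNReal.ofReal_le_ofReal ?_
        refine le_trans ?_ (Real.rpow_add_le_add_rpow dist_nonneg (by positivity) hp0.le hp1)
        refine Real.rpow_le_rpow dist_nonneg ?_ hp0.le
        have := dist_triangle4 w.1 z.1 z.2 w.2
        have := hfε _ _ h₁
        have := hfε _ _ h₂.symm
        linarith
    _ = _ := by
        rw [lintegral_add_right _ measurable_const, lintegral_const]
        rfl

lemma W_le_transportCost_of_map [OpensMeasurableSpace E] [SecondCountableTopology E] {p : ℝ}
    (hp0 : 0 < p) (hp1 : p ≤ 1) {j : X → E} (hj : Measurable j) (hiso : Isometry j)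
    {ρ σ : Measure X} [IsFiniteMeasure ρ] [IsFiniteMeasure σ] {γ : Measure (E × E)}
    [IsFiniteMeasure γ] (hγ : γ ∈ couplings (ρ.map j) (σ.map j)) :
    W p ρ σ ≤ transportCost p γ := by
  have hlim : Tendsto (fun ε : ℝ => transportCost p γ + ENNReal.ofReal ((ε + ε) ^ p) * γ univ)
      (𝓝[>] 0) (𝓝 (transportCost p γ + ENNReal.ofReal ((0 + 0 : ℝ) ^ p) * γ univ)) := by
    refine Tendsto.mono_left (Tendsto.const_add _ (ENNReal.Tendsto.mul_const ?_
      (Or.inr (measure_ne_top _ _)))) nhdsWithin_le_nhds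
    refine ENNReal.tendsto_ofReal (Continuous.tendsto (f := fun ε : ℝ => (ε + ε) ^ p) ?_ 0)
    exact (Real.continuous_rpow_const hp0.le).comp (by fun_prop)
  rw [add_zero, Real.zero_rpow hp0.ne', ENNReal.ofReal_zero, zero_mul, add_zero] at hlim
  exact ge_of_tendsto hlim (eventually_nhdsWithin_of_forall fun ε hε =>
    W_le_transportCost_add hp0 hp1 hj hiso hγ hε)

end MeasureTheory

namespace MeasureTheory

lemma Measure.le_of_forall_lintegral_le {E : Type*} [MeasurableSpace E] [PseudoMetricSpace E]
    [BorelSpace E] {ρ σ : Measure E} [IsFiniteMeasure ρ] [IsFiniteMeasure σ]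
    (h : ∀ f : E →ᵇ ℝ≥0, ∫⁻ x, f x ∂ρ ≤ ∫⁻ x, f x ∂σ) : ρ ≤ σ := by
  have hclosed : ∀ F : Set E, IsClosed F → ρ F ≤ σ F := fun F hF =>
    ge_of_tendsto' (HasOuterApproxClosed.tendsto_lintegral_apprSeq hF σ) fun n =>
      (HasOuterApproxClosed.measure_le_lintegral hF ρ n).trans (h _)
  refine Measure.le_iff.2 fun s hs => ?_
  rw [hs.measure_eq_iSup_isClosed_of_ne_top (measure_ne_top ρ s)]
  exact iSup₂_le fun F hFs => iSup_le fun hF => (hclosed F hF).trans (measure_mono hFs)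

section Compactness

variable {E : Type*} [MeasurableSpace E] [MetricSpace E] [BorelSpace E]
  [SecondCountableTopology E]

/-- Partial transport plans between `ρ` and `σ`. -/
def subplans (ρ σ : Measure E) : Set (FiniteMeasure (E × E)) :=
  {γ | (γ : Measure (E × E)).map Prod.fst ≤ ρ ∧ (γ : Measure (E × E)).map Prod.snd ≤ σ}

lemma isClosed_map_le {F : Type*} [MeasurableSpace F] [PseudoMetricSpace F] [BorelSpace F]
    {π : E × E → F} (hπ : Continuous π) (hπm : Measurable π) (ρ : Measure F) [IsFiniteMeasure ρ] :
    IsClosed {γ : FiniteMeasure (E × E) | (γ : Measure (E × E)).map π ≤ ρ} := by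
  have : {γ : FiniteMeasure (E × E) | (γ : Measure (E × E)).map π ≤ ρ} =
      ⋂ f : F →ᵇ ℝ≥0, {γ : FiniteMeasure (E × E) | ∫⁻ z, f (π z) ∂(γ : Measure (E × E)) ≤ ∫⁻ x, f x ∂ρ} := by
    ext γ
    have hmap : ∀ f : F →ᵇ ℝ≥0, ∫⁻ x, f x ∂((γ : Measure (E × E)).map π) =
        ∫⁻ z, f (π z) ∂(γ : Measure (E × E)) := fun f =>
      lintegral_map f.measurable_coe_ennreal_comp hπm
    simp only [mem_ofPred_eq, mem_iInter, ← hmap]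
    exact ⟨fun h f => lintegral_mono' h le_rfl, Measure.le_of_forall_lintegral_le⟩
  rw [this]
  refine isClosed_iInter fun f => isClosed_le ?_ continuous_const
  refine continuous_iff_continuousAt.2 fun γ => ?_
  exact FiniteMeasure.tendsto_iff_forall_lintegral_tendsto.1 tendsto_id
    (f.compContinuous ⟨π, hπ⟩)

lemma isCompact_subplans [CompleteSpace E] (ρ σ : Measure E) [IsFiniteMeasure ρ]
    [IsFiniteMeasure σ] : IsCompact (subplans ρ σ) := by
  have hu : Tendsto (fun n : ℕ => (1 : ℝ≥0) / ((n : ℝ≥0) + 1)) atTop (𝓝 0) :=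
    tendsto_one_div_add_atTop_nhds_zero_nat
  have htight : IsTightMeasureSet (FiniteMeasure.toMeasure '' subplans ρ σ) := by
    have key : ∀ (τ : Measure E) [IsFiniteMeasure τ] (S : Set (Measure E)),
        (∀ m ∈ S, m ≤ τ) → IsTightMeasureSet S := fun τ _ S hS => by
      rw [isTightMeasureSet_iff_exists_isCompact_measure_compl_le]
      intro ε hε
      obtain ⟨K, hK, hKε⟩ := isTightMeasureSet_iff_exists_isCompact_measure_compl_le.1
        (isTightMeasureSet_singleton (μ := τ)) ε hε
      exact ⟨K, hK, fun m hm => (hS m hm _).trans (hKε τ rfl)⟩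
    refine IsTightMeasureSet.prodMk (key ρ _ ?_) (key σ _ ?_)
    · rintro _ ⟨_, ⟨γ, hγ, rfl⟩, rfl⟩
      exact hγ.1
    · rintro _ ⟨_, ⟨γ, hγ, rfl⟩, rfl⟩
      exact hγ.2
  rw [isTightMeasureSet_iff_exists_isCompact_measure_compl_le] at htight
  choose K hK hKε using fun n : ℕ =>
    htight ((1 / ((n : ℝ≥0) + 1) : ℝ≥0) : ℝ≥0∞) (by positivity)
  refine (isCompact_setOfPred_finiteMeasure_mass_le_compl_isCompact_le (ρ univ).toNNReal hu hK
    (Or.inl inferInstance)).of_isClosed_subset ?_ ?_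
  · exact (isClosed_map_le continuous_fst measurable_fst ρ).inter
      (isClosed_map_le continuous_snd measurable_snd σ)
  · refine fun γ hγ => ⟨?_, fun n => ?_⟩
    · rw [← ENNReal.coe_le_coe, FiniteMeasure.ennreal_mass,
        ENNReal.coe_toNNReal (measure_ne_top _ _)]
      simpa [Measure.map_apply measurable_fst .univ] using hγ.1 univ
    · rw [← ENNReal.coe_le_coe, FiniteMeasure.ennreal_coeFn_eq_coeFn_toMeasure]
      exact hKε n γ ⟨γ, hγ, rfl⟩

lemma lowerSemicontinuous_transportCost {p : ℝ} (hp : 0 ≤ p) :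
    LowerSemicontinuous fun γ : FiniteMeasure (E × E) =>
      transportCost p (γ : Measure (E × E)) := by
  set c : E × E → ℝ≥0 := fun z => (dist z.1 z.2 ^ p).toNNReal
  have hc : Continuous c :=
    continuous_real_toNNReal.comp ((Real.continuous_rpow_const hp).comp continuous_dist)
  have hfc : ∀ k : ℕ, Continuous fun z => min (c z) k := fun k => hc.min continuous_const
  set f : ℕ → E × E →ᵇ ℝ≥0 := fun k => .mkOfBound ⟨_, hfc k⟩ k fun z w =>
    (Real.dist_le_of_mem_Icc (x' := 0) (y' := k)
      ⟨NNReal.coe_nonneg _, NNReal.coe_le_coe.2 (min_le_right _ _)⟩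
      ⟨NNReal.coe_nonneg _, NNReal.coe_le_coe.2 (min_le_right _ _)⟩).trans_eq (sub_zero _)
  have hsup : ∀ γ : FiniteMeasure (E × E), transportCost p (γ : Measure (E × E)) =
      ⨆ k, ∫⁻ z, f k z ∂(γ : Measure (E × E)) := fun γ => by
    rw [← lintegral_iSup fun k => (f k).measurable_coe_ennreal_comp]
    · refine lintegral_congr fun z => le_antisymm ?_ (iSup_le fun k => ?_)
      · obtain ⟨k, hk⟩ := exists_nat_ge (c z)
        exact le_iSup_of_le k (ENNReal.coe_le_coe.2 (le_min le_rfl hk))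
      · exact ENNReal.coe_le_coe.2 (min_le_left _ _)
    · exact fun k l hkl z => ENNReal.coe_le_coe.2 (min_le_min_left _ (Nat.cast_le.2 hkl))
  simp_rw [hsup]
  refine lowerSemicontinuous_iSup fun k => Continuous.lowerSemicontinuous ?_
  exact continuous_iff_continuousAt.2 fun γ =>
    FiniteMeasure.tendsto_iff_forall_lintegral_tendsto.1 tendsto_id (f k)

lemma exists_isMinOn_subplanCost [CompleteSpace E] {p : ℝ} (hp : 0 ≤ p) (α β : ℝ)
    (ρ σ : Measure E) [IsFiniteMeasure ρ] [IsFiniteMeasure σ] :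
    ∃ γ ∈ subplans ρ σ, IsMinOn
      (fun γ : FiniteMeasure (E × E) => subplanCost p α β ρ σ (γ : Measure (E × E)))
      (subplans ρ σ) γ := by
  refine LowerSemicontinuousOn.exists_isMinOn ⟨0, ?_⟩ (isCompact_subplans ρ σ) ?_
  · simp [subplans, Measure.zero_le]
  refine LowerSemicontinuous.lowerSemicontinuousOn ?_ _
  have hmass : Continuous fun γ : FiniteMeasure (E × E) => (γ : Measure (E × E)) univ := by
    simp_rw [← FiniteMeasure.ennreal_mass]
    fun_prop
  refine ((lowerSemicontinuous_transportCost hp).add (Continuous.lowerSemicontinuous ?_)).add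
    (Continuous.lowerSemicontinuous ?_)
  · exact (ENNReal.continuous_const_mul ENNReal.ofReal_ne_top).comp (hmass.add hmass)
  · refine (ENNReal.continuous_const_mul ENNReal.ofReal_ne_top).comp (.add ?_ ?_)
    · exact (ENNReal.continuous_sub_left (measure_ne_top ρ _)).comp hmass
    · exact (ENNReal.continuous_sub_left (measure_ne_top σ _)).comp hmass

end Compactness

variable {X E : Type*} [MeasurableSpace X] [PseudoMetricSpace X]

lemma transportCost_map [MeasurableSpace E] [PseudoMetricSpace E] [OpensMeasurableSpace E]
    [SecondCountableTopology E] (p : ℝ) {j : X → E} (hj : Measurable j) (hiso : Isometry j)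
    (γ : Measure (X × X)) :
    transportCost p (γ.map (Prod.map j j)) = transportCost p γ := by
  have hm : Measurable fun z : E × E => ENNReal.ofReal (dist z.1 z.2 ^ p) := by fun_prop
  rw [transportCost, lintegral_map hm (hj.prodMap hj)]
  simp [transportCost, hiso.dist_eq]

theorem exists_KRnorm_eq [MeasurableSpace E] [MetricSpace E] [BorelSpace E]
    [SecondCountableTopology E] [CompleteSpace E] {j : X → E} (hj : Measurable j)
    (hiso : Isometry j) {p : ℝ} (hp0 : 0 < p) (hp1 : p ≤ 1) (α β : ℝ) (μ : SignedMeasure X) :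
    ∃ ν : SignedMeasure X, ν univ = 0 ∧
      KRnorm p α β μ = W p (pos ν) (neg ν) + ENNReal.ofReal (β / 2) * tv ν +
        ENNReal.ofReal α * tv (μ - ν) := by
  have hjj : Measurable (Prod.map j j) := hj.prodMap hj
  obtain ⟨γ, hγ, hmin⟩ := exists_isMinOn_subplanCost hp0.le α β ((pos μ).map j) ((neg μ).map j)
  obtain ⟨ρ, hρ, hργ⟩ := Measure.exists_map_eq_of_le_map hj hγ.1
  obtain ⟨σ, hσ, hσγ⟩ := Measure.exists_map_eq_of_le_map hj hγ.2
  have : IsFiniteMeasure ρ := isFiniteMeasure_of_le _ hρ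
  have : IsFiniteMeasure σ := isFiniteMeasure_of_le _ hσ
  have hρu : ρ univ = (γ : Measure (E × E)) univ := by
    simpa [Measure.map_apply hj .univ, Measure.map_apply measurable_fst .univ] using
      congrArg (fun m : Measure E => m univ) hργ
  have hσu : σ univ = (γ : Measure (E × E)) univ := by
    simpa [Measure.map_apply hj .univ, Measure.map_apply measurable_snd .univ] using
      congrArg (fun m : Measure E => m univ) hσγ
  have hbal : (ρ.toSignedMeasure - σ.toSignedMeasure) univ = 0 := by
    simp [measureReal_def, hρu, hσu]
  refine ⟨ρ.toSignedMeasure - σ.toSignedMeasure, hbal, le_antisymm (iInf₂_le (ρ.toSignedMeasure - σ.toSignedMeasure) hbal) ?_⟩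
  refine le_iInf₂ fun ν _ => ?_
  have hW : W p ρ σ ≤ transportCost p (γ : Measure (E × E)) :=
    W_le_transportCost_of_map hp0 hp1 hj hiso ⟨hργ.symm, hσγ.symm⟩
  rw [W.eq_def p (pos ν)]
  simp only [ENNReal.iInf_add]
  refine le_iInf₂ fun η hη => ?_
  obtain ⟨γ', h₁, h₂, hcost⟩ := exists_subplanCost_le p α β μ ν hη
  have hfin : IsFiniteMeasure γ' := by
    constructor
    have := (h₁ univ).trans_lt (measure_lt_top _ _)
    rwa [Measure.map_apply measurable_fst .univ] at this
  have hmem : (⟨γ'.map (Prod.map j j), inferInstance⟩ : FiniteMeasure (E × E)) ∈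
      subplans ((pos μ).map j) ((neg μ).map j) := by
    constructor
    · rw [FiniteMeasure.toMeasure_mk, Measure.map_map measurable_fst hjj, Prod.map_fst',
        ← Measure.map_map hj measurable_fst]
      exact Measure.map_mono h₁ hj
    · rw [FiniteMeasure.toMeasure_mk, Measure.map_map measurable_snd hjj, Prod.map_snd',
        ← Measure.map_map hj measurable_snd]
      exact Measure.map_mono h₂ hj
  have hmap : ∀ m : Measure X, m.map j univ = m univ := fun m => by
    rw [Measure.map_apply hj .univ, preimage_univ]
  calc _ ≤ W p ρ σ + ENNReal.ofReal (β / 2) * (ρ univ + ρ univ) +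
        ENNReal.ofReal α * ((pos μ univ - ρ univ) + (neg μ univ - ρ univ)) :=
        cost_toSignedMeasure_sub_le p α β μ hρ hσ (hρu.trans hσu.symm)
    _ ≤ subplanCost p α β ((pos μ).map j) ((neg μ).map j) (γ : Measure (E × E)) := by
        rw [subplanCost, hρu, hmap, hmap]
        gcongr
    _ ≤ subplanCost p α β ((pos μ).map j) ((neg μ).map j) (γ'.map (Prod.map j j)) := hmin hmem
    _ = subplanCost p α β (pos μ) (neg μ) γ' := by
        rw [subplanCost, subplanCost, transportCost_map p hj hiso, hmap, hmap,
          Measure.map_apply hjj .univ, preimage_univ]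
    _ ≤ _ := hcost

end MeasureTheory

/-- exactness of the infimal convolution defining the KR norm. -/
theorem KRnorm_exact {n : ℕ} (Ω : Set (EuclideanSpace ℝ (Fin n))) (hΩ : Convex ℝ Ω)
    (p α β : ℝ) (hp0 : 0 < p) (hp1 : p ≤ 1) (hα : 0 < α) (hβ : 0 < β)
    (μ : SignedMeasure ↥Ω) :
    ∃ ν : SignedMeasure ↥Ω, ν Set.univ = 0 ∧
      KRnorm p α β μ =
        W p (pos ν) (neg ν) + ENNReal.ofReal (β / 2) * tv ν
          + ENNReal.ofReal α * tv (μ - ν) := by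
  exact exists_KRnorm_eq measurable_subtype_coe isometry_subtype_coe hp0 hp1 α β μ
end

section
/- Let Ω ⊆ ℝⁿ and p ∈ (0,1). Then for every pair (x, y) ∈ Ω × Ω with x ≠ y, the rescaled dipole (δ_x − δ_y)/|x−y|^p is an extremal point of the set B_p := { μ ∈ M(Ω) : μ(Ω) = 0 and W_p(μ⁺, μ⁻) ≤ 1 }. -/
open MeasureTheory ENNReal

open Set Filter Topology

/-- Quantitative subadditivity of `t ↦ t ^ p`. -/
lemma add_rpow_add_min_rpow_le {p : ℝ} (hp0 : 0 ≤ p) (hp1 : p ≤ 1) {s t : ℝ} (hs : 0 < s)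
    (ht : 0 ≤ t) : (s + t) ^ p + (1 - p) * min s t ^ p ≤ s ^ p + t ^ p := by
  have key : ∀ M m : ℝ, 0 < m → m ≤ M → (M + m) ^ p + (1 - p) * m ^ p ≤ M ^ p + m ^ p := by
    intro M m hm hmM
    have hM : 0 < M := hm.trans_le hmM
    have h1 : (1 + m / M) ^ p ≤ 1 + p * (m / M) :=
      rpow_one_add_le_one_add_mul_self (by linarith [div_nonneg hm.le hM.le]) hp0 hp1
    have h2 : (M + m) ^ p = M ^ p * (1 + m / M) ^ p := by
      rw [← Real.mul_rpow hM.le (by positivity)]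
      congr 1
      field_simp
    have h3 : M ^ p * (m / M) ≤ m ^ p := by
      have h4 : m / M ≤ (m / M) ^ p := by
        simpa using Real.rpow_le_rpow_of_exponent_ge (div_pos hm hM)
          ((div_le_one hM).2 hmM) hp1
      calc M ^ p * (m / M) ≤ M ^ p * (m / M) ^ p := by gcongr
        _ = m ^ p := by
          rw [← Real.mul_rpow hM.le (by positivity), mul_div_cancel₀ _ hM.ne']
    have h5 : M ^ p * (1 + m / M) ^ p ≤ M ^ p * (1 + p * (m / M)) := by gcongr
    have h6 : p * (M ^ p * (m / M)) ≤ p * m ^ p := by gcongr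
    rw [h2]
    linarith
  rcases ht.eq_or_lt with rfl | ht
  · rcases hp0.eq_or_lt with rfl | hp
    · simp
    · simp [hs.le, Real.zero_rpow hp.ne']
  rcases le_total s t with h | h
  · rw [min_eq_left h, add_comm s t, add_comm (s ^ p)]
    exact key t s hs h
  · rw [min_eq_right h]
    exact key s t ht h

/-- The truncated snowflake distance to a point is 1-Lipschitz for the snowflake distance,
with a quantitative gain away from that point. -/
lemma min_dist_rpow_sub_le {X : Type*} [PseudoMetricSpace X] {p : ℝ} (hp0 : 0 ≤ p) (hp1 : p ≤ 1)
    (T : ℝ) {r : ℝ} (hr : 0 < r) {x a : X} (b : X) (ha : r ≤ dist a x) :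
    min (dist b x ^ p) T - min (dist a x ^ p) T + (1 - p) * min r (dist a b) ^ p
      ≤ dist a b ^ p := by
  have hs : 0 < dist a x := hr.trans_le ha
  have ht : 0 ≤ dist a b := dist_nonneg
  have h1 := add_rpow_add_min_rpow_le hp0 hp1 hs ht
  have h2 : min r (dist a b) ^ p ≤ min (dist a x) (dist a b) ^ p :=
    Real.rpow_le_rpow (le_min hr.le ht) (min_le_min_right _ ha) hp0
  have h3 : (1 - p) * min r (dist a b) ^ p ≤ (1 - p) * min (dist a x) (dist a b) ^ p :=
    mul_le_mul_of_nonneg_left h2 (by linarith)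
  have h4 : dist b x ^ p ≤ (dist a x + dist a b) ^ p :=
    Real.rpow_le_rpow dist_nonneg (by linarith [dist_triangle b a x, dist_comm a b]) hp0
  have h5 : dist a x ^ p ≤ (dist a x + dist a b) ^ p :=
    Real.rpow_le_rpow dist_nonneg (by linarith) hp0
  rcases le_total T (dist a x ^ p) with h | h
  · rw [min_eq_right h]
    linarith [min_le_right (dist b x ^ p) T]
  · rw [min_eq_left h]
    linarith [min_le_left (dist b x ^ p) T]

lemma min_dist_rpow_sub_le_dist_rpow {X : Type*} [PseudoMetricSpace X] {p : ℝ} (hp0 : 0 < p)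
    (hp1 : p ≤ 1) (T : ℝ) (x a b : X) :
    min (dist b x ^ p) T - min (dist a x ^ p) T ≤ dist a b ^ p := by
  rcases (dist_nonneg (x := a) (y := x)).eq_or_lt with h | h
  · have h1 : dist b x ≤ dist a b := by linarith [dist_triangle b a x, dist_comm a b]
    have h2 : dist b x ^ p ≤ dist a b ^ p := Real.rpow_le_rpow dist_nonneg h1 hp0.le
    rw [← h, Real.zero_rpow hp0.ne']
    have h3 : 0 ≤ dist b x ^ p := by positivity
    rcases le_total 0 T with hT | hT
    · rw [min_eq_left hT]
      linarith [min_le_left (dist b x ^ p) T]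
    · rw [min_eq_right hT, min_eq_right (hT.trans h3)]
      linarith
  · have h1 := min_dist_rpow_sub_le hp0.le hp1 T h b le_rfl
    have h2 : 0 ≤ (1 - p) * min (dist a x) (dist a b) ^ p :=
      mul_nonneg (by linarith) (Real.rpow_nonneg (le_min dist_nonneg dist_nonneg) _)
    linarith

/-- A Kantorovich potential for the dipole at `x`, `y` and the cost `dist ^ p`. -/
noncomputable def dipolePotential {X : Type*} [PseudoMetricSpace X] (p : ℝ) (x y z : X) : ℝ :=
  (min (dist z y ^ p) (dist x y ^ p) - min (dist z x ^ p) (dist x y ^ p)) / 2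

section Potential

variable {X : Type*} [PseudoMetricSpace X] {p : ℝ}

lemma continuous_dipolePotential (hp0 : 0 ≤ p) (x y : X) :
    Continuous (dipolePotential p x y) := by
  have h : ∀ w : X, Continuous fun z => dist z w ^ p := fun w =>
    (Real.continuous_rpow_const hp0).comp (by fun_prop : Continuous fun z => dist z w)
  exact (((h y).min continuous_const).sub ((h x).min continuous_const)).div_const 2

lemma abs_dipolePotential_le (x y z : X) : |dipolePotential p x y z| ≤ dist x y ^ p := by
  have h1 : 0 ≤ dist x y ^ p := by positivity
  have h2 : 0 ≤ min (dist z y ^ p) (dist x y ^ p) := le_min (by positivity) h1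
  have h3 : 0 ≤ min (dist z x ^ p) (dist x y ^ p) := le_min (by positivity) h1
  have h4 := min_le_right (dist z y ^ p) (dist x y ^ p)
  have h5 := min_le_right (dist z x ^ p) (dist x y ^ p)
  rw [dipolePotential, abs_le]
  constructor <;> linarith

lemma dipolePotential_sub (hp0 : 0 < p) (x y : X) :
    dipolePotential p x y x - dipolePotential p x y y = dist x y ^ p := by
  have h1 : 0 ≤ dist x y ^ p := by positivity
  simp only [dipolePotential, dist_self, Real.zero_rpow hp0.ne', dist_comm y x, min_self,
    min_eq_left h1]
  ring

lemma dipolePotential_sub_le (hp0 : 0 < p) (hp1 : p ≤ 1) (x y a b : X) :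
    dipolePotential p x y a - dipolePotential p x y b ≤ dist a b ^ p := by
  have h1 := min_dist_rpow_sub_le_dist_rpow hp0 hp1 (dist x y ^ p) x a b
  have h2 := min_dist_rpow_sub_le_dist_rpow hp0 hp1 (dist x y ^ p) y b a
  rw [dist_comm b a] at h2
  simp only [dipolePotential]
  linarith

lemma dipolePotential_sub_add_le (hp0 : 0 < p) (hp1 : p ≤ 1) {r : ℝ} (hr : 0 < r) (x y a b : X)
    (hab : r ≤ dist a x ∨ r ≤ dist b y) :
    dipolePotential p x y a - dipolePotential p x y b + (1 - p) / 2 * min r (dist a b) ^ p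
      ≤ dist a b ^ p := by
  rcases hab with h | h
  · have h1 := min_dist_rpow_sub_le hp0.le hp1 (dist x y ^ p) hr b h
    have h2 := min_dist_rpow_sub_le_dist_rpow hp0 hp1 (dist x y ^ p) y b a
    rw [dist_comm b a] at h2
    simp only [dipolePotential]
    linarith
  · have h1 := min_dist_rpow_sub_le_dist_rpow hp0 hp1 (dist x y ^ p) x a b
    have h2 := min_dist_rpow_sub_le hp0.le hp1 (dist x y ^ p) hr a h
    rw [dist_comm b a] at h2
    simp only [dipolePotential]
    linarith

/-- The potential stays admissible under small Lipschitz perturbations which vanish near the two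
points of the dipole. -/
lemma exists_dipolePotential_perturbation (hp0 : 0 < p) (hp1 : p < 1) {r : ℝ} (hr : 0 < r)
    (hr1 : r ≤ 1) {K : ℝ} (hK : 0 ≤ K) (x y : X) (h : X → ℝ) (h01 : ∀ z, h z ∈ Icc (0 : ℝ) 1)
    (hL : ∀ a b, |h a - h b| ≤ K * dist a b)
    (hx : ∀ z, dist z x < r → h z = 0) (hy : ∀ z, dist z y < r → h z = 0) :
    ∃ ε : ℝ, 0 < ε ∧ ∀ σ : ℝ, |σ| ≤ ε → ∀ a b,
      (dipolePotential p x y a + σ * h a) - (dipolePotential p x y b + σ * h b)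
        ≤ dist a b ^ p := by
  have hC : 0 < 1 / r + K := by positivity
  refine ⟨(1 - p) / 2 / (1 / r + K), by have := sub_pos.2 hp1; positivity, ?_⟩
  intro σ hσ a b
  by_cases hab : r ≤ dist a x ∨ r ≤ dist b y
  · have h1 := dipolePotential_sub_add_le hp0 hp1.le hr x y a b hab
    have hm0 : 0 ≤ min r (dist a b) := le_min hr.le dist_nonneg
    have h2 : |h a - h b| ≤ (1 / r + K) * min r (dist a b) := by
      rcases le_total r (dist a b) with hd | hd
      · rw [min_eq_left hd]
        have h3 : |h a - h b| ≤ 1 := by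
          rw [abs_le]
          constructor <;> linarith [(h01 a).1, (h01 a).2, (h01 b).1, (h01 b).2]
        have h4 : (1 / r + K) * r = 1 + K * r := by field_simp
        nlinarith [mul_nonneg hK hr.le]
      · rw [min_eq_right hd]
        have h3 : 0 ≤ 1 / r * dist a b := by positivity
        linarith [hL a b]
    have h3 : min r (dist a b) ≤ min r (dist a b) ^ p := by
      rcases hm0.eq_or_lt with h0 | h0
      · rw [← h0, Real.zero_rpow hp0.ne']
      · simpa using Real.rpow_le_rpow_of_exponent_ge h0 ((min_le_left _ _).trans hr1) hp1.le
    have h4 : σ * (h a - h b) ≤ (1 - p) / 2 * min r (dist a b) ^ p := by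
      calc σ * (h a - h b) ≤ |σ| * |h a - h b| := by rw [← abs_mul]; exact le_abs_self _
        _ ≤ ((1 - p) / 2 / (1 / r + K)) * ((1 / r + K) * min r (dist a b)) := by
          gcongr
        _ = (1 - p) / 2 * min r (dist a b) := by field_simp
        _ ≤ (1 - p) / 2 * min r (dist a b) ^ p := by
          have := sub_pos.2 hp1
          gcongr
    linarith
  · push Not at hab
    rw [hx a hab.1, hy b hab.2]
    linarith [dipolePotential_sub_le hp0 hp1.le x y a b]

end Potential

lemma ofReal_integral_le_lintegral_ofReal {X : Type*} [MeasurableSpace X] {μ : Measure X}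
    {f : X → ℝ} (hf : Integrable f μ) :
    ENNReal.ofReal (∫ x, f x ∂μ) ≤ ∫⁻ x, ENNReal.ofReal (f x) ∂μ := by
  rw [integral_eq_lintegral_pos_part_sub_lintegral_neg_part hf]
  refine (ENNReal.ofReal_le_ofReal (sub_le_self _ ENNReal.toReal_nonneg)).trans ?_
  exact ENNReal.ofReal_toReal_le

/-- The easy half of Kantorovich duality. -/
lemma integral_sub_integral_le_of_W_le {X : Type*} [MeasurableSpace X] [PseudoMetricSpace X]
    {p : ℝ} {μ ν : Measure X} [IsFiniteMeasure μ] {c : ℝ} (hc : 0 ≤ c)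
    (hW : W p μ ν ≤ ENNReal.ofReal c) {g : X → ℝ} (hμ : Integrable g μ) (hν : Integrable g ν)
    (hg : ∀ a b, g a - g b ≤ dist a b ^ p) :
    ∫ z, g z ∂μ - ∫ z, g z ∂ν ≤ c := by
  rw [← ENNReal.ofReal_le_ofReal_iff hc]
  refine le_trans ?_ hW
  refine le_iInf₂ fun γ hγ => ?_
  obtain ⟨rfl, rfl⟩ := hγ
  have i1 : Integrable (fun z : X × X => g z.1) γ := hμ.comp_measurable measurable_fst
  have i2 : Integrable (fun z : X × X => g z.2) γ := hν.comp_measurable measurable_snd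
  rw [integral_map measurable_fst.aemeasurable hμ.aestronglyMeasurable,
    integral_map measurable_snd.aemeasurable hν.aestronglyMeasurable, ← integral_sub i1 i2]
  refine (ofReal_integral_le_lintegral_ofReal (i1.sub i2)).trans ?_
  exact lintegral_mono fun z => ENNReal.ofReal_le_ofReal (hg z.1 z.2)

section JordanParts

variable {X : Type*} [MeasurableSpace X]

instance (v : SignedMeasure X) : IsFiniteMeasure (pos v) :=
  v.toJordanDecomposition.posPart_finite

instance (v : SignedMeasure X) : IsFiniteMeasure (neg v) :=
  v.toJordanDecomposition.negPart_finite

lemma apply_eq_pos_real_sub_neg_real (v : SignedMeasure X) {A : Set X} (hA : MeasurableSet A) :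
    v A = (pos v).real A - (neg v).real A := by
  conv_lhs => rw [← v.toSignedMeasure_toJordanDecomposition]
  rw [JordanDecomposition.toSignedMeasure, sub_apply,
    Measure.toSignedMeasure_apply_measurable hA, Measure.toSignedMeasure_apply_measurable hA]
  rfl

lemma integral_pos_sub_integral_neg_eq {v : SignedMeasure X} {μ ν : Measure X}
    [IsFiniteMeasure μ] [IsFiniteMeasure ν] (h : v = μ.toSignedMeasure - ν.toSignedMeasure)
    {g : X → ℝ} (hg : ∀ m : Measure X, IsFiniteMeasure m → Integrable g m) :
    ∫ z, g z ∂(pos v) - ∫ z, g z ∂(neg v) = ∫ z, g z ∂μ - ∫ z, g z ∂ν := by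
  have hm : pos v + ν = μ + neg v := by
    ext A hA
    have h1 := apply_eq_pos_real_sub_neg_real v hA
    nth_rw 1 [h] at h1
    rw [sub_apply, Measure.toSignedMeasure_apply_measurable hA,
      Measure.toSignedMeasure_apply_measurable hA] at h1
    rw [← measureReal_eq_measureReal_iff, measureReal_add_apply, measureReal_add_apply]
    linarith
  have hi := congrArg (fun m => ∫ z, g z ∂m) hm
  rw [integral_add_measure (hg _ inferInstance) (hg _ inferInstance),
    integral_add_measure (hg _ inferInstance) (hg _ inferInstance)] at hi
  linarith

lemma integral_pos_sub_integral_neg_add_smul (v w : SignedMeasure X) {a b : ℝ} (ha : 0 ≤ a)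
    (hb : 0 ≤ b) {g : X → ℝ} (hg : ∀ m : Measure X, IsFiniteMeasure m → Integrable g m) :
    ∫ z, g z ∂(pos (a • v + b • w)) - ∫ z, g z ∂(neg (a • v + b • w)) =
      a * (∫ z, g z ∂(pos v) - ∫ z, g z ∂(neg v)) +
        b * (∫ z, g z ∂(pos w) - ∫ z, g z ∂(neg w)) := by
  lift a to NNReal using ha
  lift b to NNReal using hb
  rw [integral_pos_sub_integral_neg_eq (μ := a • pos v + b • pos w)
    (ν := a • neg v + b • neg w) ?_ hg]
  · rw [integral_add_measure (hg _ inferInstance) (hg _ inferInstance),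
      integral_add_measure (hg _ inferInstance) (hg _ inferInstance)]
    simp only [integral_smul_nnreal_measure, NNReal.smul_def, smul_eq_mul]
    ring
  · ext A hA
    rw [sub_apply, Measure.toSignedMeasure_apply_measurable hA,
      Measure.toSignedMeasure_apply_measurable hA, measureReal_add_apply, measureReal_add_apply]
    simp only [add_apply, smul_apply, smul_eq_mul,
      measureReal_nnreal_smul_apply, apply_eq_pos_real_sub_neg_real v hA,
      apply_eq_pos_real_sub_neg_real w hA]
    ring

lemma toJordanDecomposition_smul_sDirac_sub [MeasurableSingletonClass X] {x y : X} (hxy : x ≠ y)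
    (c : NNReal) :
    pos ((c : ℝ) • (sDirac x - sDirac y)) = c • Measure.dirac x ∧
      neg ((c : ℝ) • (sDirac x - sDirac y)) = c • Measure.dirac y := by
  have hs : Measure.dirac x ⟂ₘ Measure.dirac y :=
    ⟨{y}, measurableSet_singleton y, by simp [hxy], by simp⟩
  let j : JordanDecomposition X :=
    { posPart := c • Measure.dirac x
      negPart := c • Measure.dirac y
      posPart_finite := inferInstance
      negPart_finite := inferInstance
      mutuallySingular := (hs.smul c).symm.smul c |>.symm }
  have hj : ((c : ℝ) • (sDirac x - sDirac y)) = j.toSignedMeasure := by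
    ext A hA
    simp only [JordanDecomposition.toSignedMeasure, j, sDirac, smul_apply,
      sub_apply, Measure.toSignedMeasure_apply_measurable hA,
      measureReal_nnreal_smul_apply, smul_eq_mul]
    ring
  have h := SignedMeasure.toJordanDecomposition_eq hj
  rw [pos, neg, h]
  exact ⟨rfl, rfl⟩

end JordanParts

section Support

variable {X : Type*} [MeasurableSpace X] [MetricSpace X] [BorelSpace X]

/-- Two finite measures agreeing on the functions which vanish near `x` and `y` agree away from
these two points. -/
lemma restrict_compl_pair_eq {μ ν : Measure X} [IsFiniteMeasure μ] [IsFiniteMeasure ν] (x y : X)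
    (H : ∀ (r K : ℝ) (h : X → ℝ), 0 < r → r ≤ 1 → 0 ≤ K → Continuous h →
      (∀ z, h z ∈ Icc (0 : ℝ) 1) → (∀ a b, |h a - h b| ≤ K * dist a b) →
      (∀ z, dist z x < r → h z = 0) → (∀ z, dist z y < r → h z = 0) →
      ∫ z, h z ∂μ = ∫ z, h z ∂ν) :
    μ.restrict {x, y}ᶜ = ν.restrict {x, y}ᶜ := by
  have hclosed : ∀ F : Set X, IsClosed F → F ⊆ {x, y}ᶜ → μ F = ν F := by
    intro F hF hFxy
    have hxF : x ∈ Fᶜ := fun h => hFxy h (by simp)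
    have hyF : y ∈ Fᶜ := fun h => hFxy h (by simp)
    obtain ⟨ρ₁, hρ₁, hb₁⟩ := Metric.isOpen_iff.1 hF.isOpen_compl x hxF
    obtain ⟨ρ₂, hρ₂, hb₂⟩ := Metric.isOpen_iff.1 hF.isOpen_compl y hyF
    obtain ⟨r, hr, hr1, hrρ₁, hrρ₂⟩ :
        ∃ r : ℝ, 0 < r ∧ r ≤ 1 ∧ 2 * r ≤ ρ₁ ∧ 2 * r ≤ ρ₂ := by
      refine ⟨min 1 (min ρ₁ ρ₂) / 2, by positivity, ?_, ?_, ?_⟩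
      · linarith [min_le_left 1 (min ρ₁ ρ₂)]
      · linarith [(min_le_right 1 (min ρ₁ ρ₂)).trans (min_le_left _ _)]
      · linarith [(min_le_right 1 (min ρ₁ ρ₂)).trans (min_le_right _ _)]
    have hvan : ∀ (w : X) (ρ : ℝ), Metric.ball w ρ ⊆ Fᶜ → 2 * r ≤ ρ → ∀ δ (hδ : 0 < δ), δ ≤ r →
        ∀ z, dist z w < r → thickenedIndicator hδ F z = 0 := by
      intro w ρ hball hrρ δ hδ hδr z hz
      refine thickenedIndicator_zero hδ F fun hz' => ?_
      obtain ⟨q, hqF, hq⟩ := Metric.mem_thickening_iff.1 hz'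
      refine hball (Metric.mem_ball.2 ?_) hqF
      linarith [dist_triangle q z w, dist_comm q z]
    let δs : ℕ → ℝ := fun n => r / ((n : ℝ) + 1)
    have δs_pos : ∀ n, 0 < δs n := fun n => by positivity
    have δs_le : ∀ n, δs n ≤ r := fun n =>
      div_le_self hr.le (by linarith [(Nat.cast_nonneg n : (0 : ℝ) ≤ n)])
    have δs_lim : Tendsto δs atTop (𝓝 0) := by
      have := tendsto_one_div_add_atTop_nhds_zero_nat (𝕜 := ℝ) |>.const_mul r
      simpa [δs, div_eq_mul_inv] using this
    have h1 := tendsto_lintegral_thickenedIndicator_of_isClosed μ hF δs_pos δs_lim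
    have h2 := tendsto_lintegral_thickenedIndicator_of_isClosed ν hF δs_pos δs_lim
    refine tendsto_nhds_unique h1 (h2.congr fun n => ?_)
    set t := thickenedIndicator (δs_pos n) F
    have htc : Continuous fun z => (t z : ℝ) := NNReal.continuous_coe.comp t.continuous
    have ht01 : ∀ z, (t z : ℝ) ∈ Icc (0 : ℝ) 1 := fun z =>
      ⟨NNReal.coe_nonneg _, NNReal.coe_le_coe.2 (thickenedIndicator_le_one (δs_pos n) F z)⟩
    have hint : ∀ m : Measure X, IsFiniteMeasure m → Integrable (fun z => (t z : ℝ)) m := by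
      intro m _
      refine Integrable.of_bound htc.aestronglyMeasurable 1 (ae_of_all _ fun z => ?_)
      rw [Real.norm_of_nonneg (ht01 z).1]
      exact (ht01 z).2
    rw [lintegral_coe_eq_integral _ (hint ν inferInstance),
      lintegral_coe_eq_integral _ (hint μ inferInstance)]
    congr 1
    refine (H r _ (fun z => (t z : ℝ)) hr hr1 (NNReal.coe_nonneg (δs n).toNNReal⁻¹) htc ht01
      (fun a b => ?_) (fun z hz => ?_) (fun z hz => ?_)).symm
    · have := (lipschitzWith_thickenedIndicator (δs_pos n) F).dist_le_mul a b
      rwa [NNReal.dist_eq] at this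
    · exact NNReal.coe_eq_zero.2 <| hvan x ρ₁ hb₁ hrρ₁ _ (δs_pos n) (δs_le n) z hz
    · exact NNReal.coe_eq_zero.2 <| hvan y ρ₂ hb₂ hrρ₂ _ (δs_pos n) (δs_le n) z hz
  have hU : IsOpen ({x, y}ᶜ : Set X) := (Set.toFinite {x, y}).isClosed.isOpen_compl
  obtain ⟨E, hEc, hEU, hEun, hEmono⟩ := hU.exists_iUnion_isClosed
  have hinter : ∀ F : Set X, IsClosed F → μ (F ∩ {x, y}ᶜ) = ν (F ∩ {x, y}ᶜ) := by
    intro F hF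
    rw [← hEun, inter_iUnion]
    have hmono : Monotone fun n => F ∩ E n := fun m n hmn => inter_subset_inter_right F (hEmono hmn)
    refine tendsto_nhds_unique (tendsto_measure_iUnion_atTop (μ := μ) hmono)
      ((tendsto_measure_iUnion_atTop (μ := ν) hmono).congr fun n => ?_)
    exact (hclosed _ (hF.inter (hEc n)) (inter_subset_right.trans (hEU n))).symm
  refine ext_of_generate_finite {s | IsClosed s} ?_ isPiSystem_isClosed (fun F hF => ?_) ?_
  · rw [← borel_eq_generateFrom_isClosed]
    exact BorelSpace.measurable_eq
  · rw [Measure.restrict_apply (IsClosed.measurableSet hF),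
      Measure.restrict_apply (IsClosed.measurableSet hF)]
    exact hinter F hF
  · rw [Measure.restrict_apply MeasurableSet.univ, Measure.restrict_apply MeasurableSet.univ]
    exact hinter univ isClosed_univ

lemma integral_eq_add_of_pair {x y : X} (hxy : x ≠ y) {m : Measure X} {g : X → ℝ}
    (hg : Integrable g m) :
    ∫ z, g z ∂m = m.real {x} * g x + m.real {y} * g y + ∫ z in {x, y}ᶜ, g z ∂m := by
  have hms : MeasurableSet ({x, y} : Set X) := (Set.toFinite {x, y}).measurableSet
  rw [← integral_add_compl hms hg, Set.insert_eq, setIntegral_union (by simpa using hxy)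
    (measurableSet_singleton y) hg.integrableOn hg.integrableOn, integral_singleton,
    integral_singleton, smul_eq_mul, smul_eq_mul]

/-- A signed measure of zero mass which is tested to `1` by all admissible potentials tight on the
dipole is the dipole itself. -/
lemma eq_dipole_of_forall_integral_eq_one {p : ℝ} (hp0 : 0 < p) (hp1 : p < 1) {x y : X}
    (hxy : x ≠ y) {v : SignedMeasure X} (hv : v univ = 0)
    (H : ∀ g : X → ℝ, Continuous g → (∃ C, ∀ z, |g z| ≤ C) →
      (∀ a b, g a - g b ≤ dist a b ^ p) → g x - g y = dist x y ^ p →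
      ∫ z, g z ∂(pos v) - ∫ z, g z ∂(neg v) = 1) :
    v = (dist x y ^ p)⁻¹ • (sDirac x - sDirac y) := by
  set f := dipolePotential p x y with hf
  have hfc : Continuous f := continuous_dipolePotential hp0.le x y
  have hfi : ∀ m : Measure X, IsFiniteMeasure m → Integrable f m := fun m _ =>
    Integrable.of_bound hfc.aestronglyMeasurable _
      (ae_of_all _ fun z => abs_dipolePotential_le x y z)
  have hf1 := H f hfc ⟨_, abs_dipolePotential_le x y⟩ (dipolePotential_sub_le hp0 hp1.le x y)
    (dipolePotential_sub hp0 x y)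
  have hres : (pos v).restrict {x, y}ᶜ = (neg v).restrict {x, y}ᶜ := by
    refine restrict_compl_pair_eq x y ?_
    intro r K h hr hr1 hK hc h01 hL hhx hhy
    have hhi : ∀ m : Measure X, IsFiniteMeasure m → Integrable h m := by
      intro m _
      refine Integrable.of_bound hc.aestronglyMeasurable 1 (ae_of_all _ fun z => ?_)
      rw [Real.norm_of_nonneg (h01 z).1]
      exact (h01 z).2
    obtain ⟨ε, hε, hadm⟩ :=
      exists_dipolePotential_perturbation hp0 hp1 hr hr1 hK x y h h01 hL hhx hhy
    have h1 := H (fun z => f z + ε * h z) (hfc.add (continuous_const.mul hc))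
      ⟨dist x y ^ p + ε, fun z => (abs_add_le _ _).trans (add_le_add
        (abs_dipolePotential_le x y z) (by
          rw [abs_mul, abs_of_pos hε, abs_of_nonneg (h01 z).1]
          exact mul_le_of_le_one_right hε.le (h01 z).2))⟩
      (hadm ε (abs_of_pos hε).le)
      (by
        have := dipolePotential_sub hp0 x y
        simp only [hhx x (by simpa using hr), hhy y (by simpa using hr), hf]
        linarith)
    rw [integral_add (hfi _ inferInstance) ((hhi _ inferInstance).const_mul ε),
      integral_add (hfi _ inferInstance) ((hhi _ inferInstance).const_mul ε),
      integral_const_mul, integral_const_mul] at h1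
    have h2 : ε * (∫ z, h z ∂(pos v) - ∫ z, h z ∂(neg v)) = 0 := by linarith
    exact sub_eq_zero.1 ((mul_eq_zero.1 h2).resolve_left hε.ne')
  have hzero : ∀ A, MeasurableSet A → v (A ∩ {x, y}ᶜ) = 0 := by
    intro A hA
    have hms : MeasurableSet ({x, y}ᶜ : Set X) := (Set.toFinite {x, y}).measurableSet.compl
    have h1 := congrArg (fun m => m A) hres
    simp only [Measure.restrict_apply hA] at h1
    rw [apply_eq_pos_real_sub_neg_real v (hA.inter hms), measureReal_def, measureReal_def, h1,
      sub_self]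
  have hsplit : ∀ A, MeasurableSet A →
      v A = v {x} * A.indicator 1 x + v {y} * A.indicator 1 y := by
    intro A hA
    have hi1 : ∀ m : Measure X, IsFiniteMeasure m → Integrable (A.indicator (1 : X → ℝ)) m :=
      fun m _ => (integrable_const (1 : ℝ)).indicator hA
    have h1 := integral_eq_add_of_pair hxy (hi1 (pos v) inferInstance)
    have h2 := integral_eq_add_of_pair hxy (hi1 (neg v) inferInstance)
    rw [integral_indicator_one hA] at h1 h2
    rw [hres] at h1
    rw [apply_eq_pos_real_sub_neg_real v hA,
      apply_eq_pos_real_sub_neg_real v (measurableSet_singleton x),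
      apply_eq_pos_real_sub_neg_real v (measurableSet_singleton y)]
    linarith
  have hsum : v {x} + v {y} = 0 := by
    have := hsplit univ MeasurableSet.univ
    simp only [hv, indicator_univ, Pi.one_apply, mul_one] at this
    exact this.symm
  have hD : 0 < dist x y ^ p := Real.rpow_pos_of_pos (dist_pos.2 hxy) p
  have hvx : v {x} = (dist x y ^ p)⁻¹ := by
    have h1 := integral_eq_add_of_pair hxy (hfi (pos v) inferInstance)
    have h2 := integral_eq_add_of_pair hxy (hfi (neg v) inferInstance)
    rw [hres] at h1
    have h3 : v {x} * f x + v {y} * f y = 1 := by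
      rw [apply_eq_pos_real_sub_neg_real v (measurableSet_singleton x),
        apply_eq_pos_real_sub_neg_real v (measurableSet_singleton y)]
      linarith
    rw [eq_neg_of_add_eq_zero_right hsum] at h3
    refine eq_inv_of_mul_eq_one_left ?_
    rw [← dipolePotential_sub hp0 x y]
    linarith
  ext A hA
  rw [hsplit A hA, eq_neg_of_add_eq_zero_right hsum, hvx]
  simp only [smul_apply, sub_apply, sDirac, smul_eq_mul,
    Measure.toSignedMeasure_apply_measurable hA, measureReal_def, Measure.dirac_apply' _ hA]
  by_cases hx : x ∈ A <;> by_cases hy : y ∈ A <;> simp [hx, hy]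

/-- The rescaled dipole at two distinct points is admissible for the Wasserstein cost. -/
lemma W_dipole_le_one {p : ℝ} (x y : X) :
    W p ((dist x y ^ p).toNNReal⁻¹ • Measure.dirac x)
      ((dist x y ^ p).toNNReal⁻¹ • Measure.dirac y) ≤ 1 := by
  set c := (dist x y ^ p).toNNReal
  have hγ : c⁻¹ • Measure.dirac (x, y) ∈
      couplings (c⁻¹ • Measure.dirac x) (c⁻¹ • Measure.dirac y) :=
    ⟨by rw [Measure.map_smul, Measure.map_dirac' measurable_fst],
      by rw [Measure.map_smul, Measure.map_dirac' measurable_snd]⟩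
  refine (iInf₂_le _ hγ).trans ?_
  rw [transportCost, lintegral_smul_measure, lintegral_dirac]
  change ((c⁻¹ : NNReal) : ℝ≥0∞) * (c : ℝ≥0∞) ≤ 1
  rw [← ENNReal.coe_mul]
  exact_mod_cast inv_mul_le_one

end Support

/-- for `p ∈ (0,1)`, rescaled dipoles `(δ_x - δ_y)/|x-y|^p` are extremal
points of `B_p = {μ | μ(Ω) = 0, W_p(μ⁺, μ⁻) ≤ 1}`. -/
theorem dipole_extremePoint_Bp {n : ℕ} (Ω : Set (EuclideanSpace ℝ (Fin n)))
    (p : ℝ) (hp0 : 0 < p) (hp1 : p < 1) (x y : ↥Ω) (hxy : x ≠ y) :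
    (dist x y ^ p)⁻¹ • (sDirac x - sDirac y) ∈
      Set.extremePoints ℝ
        {μ : SignedMeasure ↥Ω | μ Set.univ = 0 ∧ W p (pos μ) (neg μ) ≤ 1} := by
  set D := dist x y ^ p
  have hDpos : 0 < D := Real.rpow_pos_of_pos (dist_pos.2 hxy) p
  have hc : D⁻¹ = ((D.toNNReal⁻¹ : NNReal) : ℝ) := by
    rw [NNReal.coe_inv, Real.coe_toNNReal _ hDpos.le]
  obtain ⟨hpos, hneg⟩ := toJordanDecomposition_smul_sDirac_sub hxy D.toNNReal⁻¹
  rw [← hc] at hpos hneg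
  rw [mem_extremePoints]
  refine ⟨⟨?_, ?_⟩, ?_⟩
  · simp [sDirac, smul_apply, sub_apply,
      Measure.toSignedMeasure_apply_measurable MeasurableSet.univ]
  · rw [hpos, hneg]
    exact W_dipole_le_one x y
  rintro v ⟨hv0, hvW⟩ w ⟨hw0, hwW⟩ ⟨a, b, ha, hb, hab, hu⟩
  have main : ∀ g : Ω → ℝ, Continuous g → (∃ C, ∀ z, |g z| ≤ C) →
      (∀ a b, g a - g b ≤ dist a b ^ p) → g x - g y = dist x y ^ p →
      ∫ z, g z ∂(pos v) - ∫ z, g z ∂(neg v) = 1 ∧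
        ∫ z, g z ∂(pos w) - ∫ z, g z ∂(neg w) = 1 := by
    rintro g hgc ⟨C, hC⟩ hg hgxy
    have hgi : ∀ m : Measure Ω, IsFiniteMeasure m → Integrable g m := fun m _ =>
      Integrable.of_bound hgc.aestronglyMeasurable C (ae_of_all _ hC)
    have h1 := integral_pos_sub_integral_neg_add_smul v w ha.le hb.le hgi
    rw [hu, hpos, hneg, integral_smul_nnreal_measure, integral_smul_nnreal_measure,
      integral_dirac, integral_dirac, ← smul_sub, hgxy, NNReal.smul_def, ← hc, smul_eq_mul,
      inv_mul_cancel₀ hDpos.ne'] at h1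
    have h2 := integral_sub_integral_le_of_W_le zero_le_one
      (by rwa [ENNReal.ofReal_one]) (hgi (pos v) inferInstance) (hgi (neg v) inferInstance) hg
    have h3 := integral_sub_integral_le_of_W_le zero_le_one
      (by rwa [ENNReal.ofReal_one]) (hgi (pos w) inferInstance) (hgi (neg w) inferInstance) hg
    constructor <;> nlinarith
  exact ⟨eq_dipole_of_forall_integral_eq_one hp0 hp1 hxy hv0
      fun g h1 h2 h3 h4 => (main g h1 h2 h3 h4).1,
    eq_dipole_of_forall_integral_eq_one hp0 hp1 hxy hw0
      fun g h1 h2 h3 h4 => (main g h1 h2 h3 h4).2⟩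
end

section
/- Let Ω ⊆ ℝⁿ be convex, p ∈ (0,1] and α, β > 0. Then for every x ∈ Ω, both Dirac masses ±(1/α)δ_x are extremal points of the set { μ ∈ M(Ω) : ‖μ‖_{KR_p^{α,β}} ≤ 1 }. -/
open MeasureTheory ENNReal

namespace MeasureTheory.SignedMeasure

variable {X : Type*} [MeasurableSpace X]

theorem abs_add_abs_compl_le_tv (w : SignedMeasure X) {A : Set X} (hA : MeasurableSet A) :
    |w A| + |w Aᶜ| ≤ (tv w).toReal := by
  calc |w A| + |w Aᶜ| ≤ w.totalVariation.real A + w.totalVariation.real Aᶜ :=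
        add_le_add (norm_le_totalVariation w A) (norm_le_totalVariation w Aᶜ)
    _ = (tv w).toReal := measureReal_add_measureReal_compl hA

theorem tv_ne_top (w : SignedMeasure X) : tv w ≠ ∞ := by
  exact measure_ne_top _ _

theorem tv_neg (w : SignedMeasure X) : tv (-w) = tv w := by
  rw [tv, tv, totalVariation_neg]

theorem apply_add_apply_compl (w : SignedMeasure X) {A : Set X} (hA : MeasurableSet A) :
    w A + w Aᶜ = w Set.univ := by
  rw [← VectorMeasure.of_union disjoint_compl_right hA hA.compl, Set.union_compl_self]

theorem tv_smul_sDirac {r : ℝ} (hr : 0 ≤ r) (x : X) : tv (r • sDirac x) = ENNReal.ofReal r := by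
  have h : (r • sDirac x).toJordanDecomposition =
      ⟨r.toNNReal • Measure.dirac x, 0, Measure.MutuallySingular.zero_right⟩ := by
    refine toJordanDecomposition_eq ?_
    ext A hA
    simp [sDirac, JordanDecomposition.toSignedMeasure, hA, NNReal.smul_def, hr]
  rw [tv, totalVariation, h]
  rw [add_zero, Measure.smul_apply, measure_univ, ENNReal.smul_def, smul_eq_mul, mul_one,
    ENNReal.ofReal]

theorem smul_sDirac_apply_univ (c : ℝ) (x : X) : (c • sDirac x) Set.univ = c := by
  simp [sDirac]

theorem smul_sDirac_apply_of_notMem (c : ℝ) {x : X} {A : Set X} (hA : MeasurableSet A)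
    (hx : x ∉ A) : (c • sDirac x) A = 0 := by
  simp [sDirac, hA, hx, measureReal_def]

/-- The pairing with the function `α - ε 1_A` is bounded by the Kantorovich-Rubinstein norm. -/
theorem abs_mul_apply_univ_sub_le_KRnorm [PseudoMetricSpace X] (p : ℝ) {α β ε : ℝ} (hε : 0 ≤ ε)
    (hεα : ε ≤ 2 * α) (hεβ : ε ≤ β) (μ : SignedMeasure X) {A : Set X} (hA : MeasurableSet A) :
    ENNReal.ofReal |α * μ Set.univ - ε * μ A| ≤ KRnorm p α β μ := by
  refine le_iInf₂ fun ν hν => ?_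
  have hν' := abs_add_abs_compl_le_tv ν hA
  have hμν := abs_add_abs_compl_le_tv (μ - ν) hA
  have hνA : ν Aᶜ = -ν A := by linarith [apply_add_apply_compl ν hA]
  have hμu := apply_add_apply_compl μ hA
  rw [hνA, abs_neg] at hν'
  simp only [sub_apply] at hμν
  rw [hνA] at hμν
  set t := (tv ν).toReal
  set s := (tv (μ - ν)).toReal
  have hα : 0 ≤ α := by linarith
  have key : |α * μ Set.univ - ε * μ A| ≤ β / 2 * t + α * s := by
    have h1 : α * μ Set.univ - ε * μ A =
        -(ε * ν A) + ((α - ε) * (μ A - ν A) + α * (μ Aᶜ - -ν A)) := by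
      rw [← hμu]; ring
    have h2 : |ε * ν A| ≤ β / 2 * t := by
      rw [abs_mul, abs_of_nonneg hε]
      nlinarith [abs_nonneg (ν A)]
    have h3 : |(α - ε) * (μ A - ν A)| ≤ α * |μ A - ν A| := by
      rw [abs_mul]
      exact mul_le_mul_of_nonneg_right (abs_le.2 ⟨by linarith, by linarith⟩) (abs_nonneg _)
    have h4 : |α * (μ Aᶜ - -ν A)| = α * |μ Aᶜ - -ν A| := by
      rw [abs_mul, abs_of_nonneg hα]
    rw [h1]
    calc _ ≤ |-(ε * ν A)| + (|(α - ε) * (μ A - ν A)| + |α * (μ Aᶜ - -ν A)|) :=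
          (abs_add_le _ _).trans (add_le_add_right (abs_add_le _ _) _)
      _ ≤ β / 2 * t + (α * |μ A - ν A| + α * |μ Aᶜ - -ν A|) := by
          rw [abs_neg, h4]; gcongr
      _ ≤ β / 2 * t + α * s := by
          rw [← mul_add]; gcongr
  calc ENNReal.ofReal |α * μ Set.univ - ε * μ A|
      ≤ ENNReal.ofReal (β / 2 * t + α * s) := ENNReal.ofReal_le_ofReal key
    _ ≤ ENNReal.ofReal (β / 2 * t) + ENNReal.ofReal (α * s) := ENNReal.ofReal_add_le
    _ = ENNReal.ofReal (β / 2) * tv ν + ENNReal.ofReal α * tv (μ - ν) := by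
        rw [ENNReal.ofReal_mul (by linarith), ENNReal.ofReal_mul hα,
          ENNReal.ofReal_toReal (tv_ne_top _), ENNReal.ofReal_toReal (tv_ne_top _)]
    _ ≤ _ := by
        rw [add_assoc]; exact le_add_self

theorem KRnorm_le_mul_tv [PseudoMetricSpace X] (p α β : ℝ) (μ : SignedMeasure X) :
    KRnorm p α β μ ≤ ENNReal.ofReal α * tv μ := by
  refine (iInf₂_le 0 (by simp)).trans ?_
  have hW : W p (pos (0 : SignedMeasure X)) (neg (0 : SignedMeasure X)) = 0 := by
    refine le_antisymm ((iInf₂_le 0 ?_).trans (by simp [transportCost])) zero_le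
    simp [couplings, pos, neg, toJordanDecomposition_zero]
  simp [hW, tv, totalVariation_zero]

theorem smul_sDirac_mem_extremePoints [PseudoMetricSpace X] (p : ℝ) {α β c : ℝ} (hα : 0 < α)
    (hβ : 0 < β) (hc : |c| = α⁻¹) (x : X) (hball : KRnorm p α β (c • sDirac x) ≤ 1) :
    c • sDirac x ∈ Set.extremePoints ℝ {μ : SignedMeasure X | KRnorm p α β μ ≤ 1} := by
  refine ⟨hball, fun v₁ hv₁ v₂ hv₂ hv => ?_⟩
  obtain ⟨a, b, ha, hb, hab, hv⟩ := hv
  have hαc : |α * c| = 1 := by rw [abs_mul, hc, abs_of_pos hα, mul_inv_cancel₀ hα.ne']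
  have bound (ε : ℝ) (hε : 0 ≤ ε) (hεα : ε ≤ 2 * α) (hεβ : ε ≤ β) (A : Set X)
      (hA : MeasurableSet A) (v : SignedMeasure X) (hv : KRnorm p α β v ≤ 1) :
      |α * v Set.univ - ε * v A| ≤ 1 :=
    ENNReal.ofReal_le_one.1 ((abs_mul_apply_univ_sub_le_KRnorm p hε hεα hεβ v hA).trans hv)
  have eq (ε : ℝ) (hε : 0 ≤ ε) (hεα : ε ≤ 2 * α) (hεβ : ε ≤ β) (A : Set X)
      (hA : MeasurableSet A) (hx : x ∉ A) : α * v₁ Set.univ - ε * v₁ A = α * c := by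
    have h₁ := abs_le.1 (bound ε hε hεα hεβ A hA v₁ hv₁)
    have h₂ := abs_le.1 (bound ε hε hεα hεβ A hA v₂ hv₂)
    have hu : a * v₁ Set.univ + b * v₂ Set.univ = c := by
      rw [← smul_sDirac_apply_univ c x, ← hv]
      simp
    have h0 : a * v₁ A + b * v₂ A = 0 := by
      rw [← smul_sDirac_apply_of_notMem c hA hx, ← hv]
      simp
    have hcomb : a * (α * v₁ Set.univ - ε * v₁ A) + b * (α * v₂ Set.univ - ε * v₂ A) = α * c := by
      linear_combination α * hu - ε * h0
    obtain rfl : b = 1 - a := by linarith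
    rcases (abs_eq zero_le_one).1 hαc with h | h <;> rw [h] at hcomb ⊢ <;> nlinarith
  have huniv : v₁ Set.univ = c := by
    have := eq 0 le_rfl (by positivity) hβ.le ∅ .empty (by simp)
    exact mul_left_cancel₀ hα.ne' (by linarith)
  have hzero (A : Set X) (hA : MeasurableSet A) (hx : x ∉ A) : v₁ A = 0 := by
    have hε : 0 < min (2 * α) β := lt_min (by positivity) hβ
    have := eq _ hε.le (min_le_left _ _) (min_le_right _ _) A hA hx
    rw [huniv, sub_eq_self] at this
    exact (mul_eq_zero.1 this).resolve_left hε.ne'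
  ext A hA
  by_cases hx : x ∈ A
  · have h₁ := apply_add_apply_compl v₁ hA
    have h₂ := apply_add_apply_compl (c • sDirac x) hA
    have hx' : x ∉ Aᶜ := by simpa using hx
    rw [hzero _ hA.compl hx', huniv] at h₁
    rw [smul_sDirac_apply_of_notMem c hA.compl hx', smul_sDirac_apply_univ] at h₂
    linarith
  · rw [hzero A hA hx, smul_sDirac_apply_of_notMem c hA hx]

end MeasureTheory.SignedMeasure

/-- the Dirac masses `±(1/α)δ_x` are extremal points of the KR unit
ball. -/
theorem dirac_extremePoint_KRball {n : ℕ} (Ω : Set (EuclideanSpace ℝ (Fin n)))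
    (hΩ : Convex ℝ Ω) (p α β : ℝ) (hp0 : 0 < p) (hp1 : p ≤ 1) (hα : 0 < α) (hβ : 0 < β)
    (x : ↥Ω) :
    α⁻¹ • sDirac x ∈
        Set.extremePoints ℝ {μ : SignedMeasure ↥Ω | KRnorm p α β μ ≤ 1} ∧
      -(α⁻¹ • sDirac x) ∈
        Set.extremePoints ℝ {μ : SignedMeasure ↥Ω | KRnorm p α β μ ≤ 1} := by
  have htv : ENNReal.ofReal α * tv (α⁻¹ • sDirac x) = 1 := by
    rw [SignedMeasure.tv_smul_sDirac (by positivity), ← ENNReal.ofReal_mul hα.le,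
      mul_inv_cancel₀ hα.ne', ENNReal.ofReal_one]
  have habs : |α⁻¹| = α⁻¹ := abs_of_pos (by positivity)
  constructor
  · exact SignedMeasure.smul_sDirac_mem_extremePoints p hα hβ habs x
      ((SignedMeasure.KRnorm_le_mul_tv p α β _).trans htv.le)
  · have hneg : -(α⁻¹ • sDirac x) = (-α⁻¹) • sDirac x := by ext; simp
    rw [hneg]
    refine SignedMeasure.smul_sDirac_mem_extremePoints p hα hβ (by rw [abs_neg, habs]) x ?_
    refine (SignedMeasure.KRnorm_le_mul_tv p α β _).trans ?_
    rw [← hneg, SignedMeasure.tv_neg, htv]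
end

section
/- Let Ω ⊆ ℝⁿ, p ∈ (0,1] and α, β > 0. Then every rescaled dipole (δ_x − δ_y)/(β + |x−y|^p) with x ≠ y and |x−y|^p ≥ 2α − β is NOT an extremal point of the set { μ ∈ M(Ω) : ‖μ‖_{KR_p^{α,β}} ≤ 1 }: it is the nontrivial convex combination (1/2)·(2/(β+|x−y|^p))δ_x + (1/2)·(−(2/(β+|x−y|^p))δ_y), and ‖c δ_z‖_{KR_p^{α,β}} = α c for every z ∈ Ω and c > 0. -/
open MeasureTheory ENNReal

section KRnorm

variable {X : Type*} [MeasurableSpace X]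

theorem smul_sDirac_apply (c : ℝ) (z : X) {s : Set X} (hs : MeasurableSet s) :
    (c • sDirac z) s = c * s.indicator 1 z := by
  rw [_root_.smul_apply, sDirac, Measure.toSignedMeasure_apply_measurable hs,
    measureReal_def, Measure.dirac_apply' _ hs, smul_eq_mul]
  by_cases hz : z ∈ s <;> simp [hz]

theorem tv_neg (μ : SignedMeasure X) : tv (-μ) = tv μ := by
  rw [tv, SignedMeasure.totalVariation_neg, tv]

theorem tv_smul_sDirac {c : ℝ} (hc : 0 ≤ c) (z : X) :
    tv (c • sDirac z) = ENNReal.ofReal c := by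
  let j : JordanDecomposition X :=
    { posPart := c.toNNReal • Measure.dirac z
      negPart := 0
      mutuallySingular := Measure.MutuallySingular.zero_right }
  have hj : c • sDirac z = j.toSignedMeasure := by
    ext s hs
    rw [smul_sDirac_apply c z hs, JordanDecomposition.toSignedMeasure,
      Measure.toSignedMeasure_sub_apply hs, measureReal_nnreal_smul_apply, measureReal_def,
      Measure.dirac_apply' _ hs, Real.coe_toNNReal c hc]
    by_cases hz : z ∈ s <;> simp [hz, j]
  rw [tv, SignedMeasure.totalVariation, SignedMeasure.toJordanDecomposition_eq hj]
  simp [j, ENNReal.ofReal]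

theorem ofReal_abs_univ_le_tv (μ : SignedMeasure X) :
    ENNReal.ofReal |μ Set.univ| ≤ tv μ := by
  simpa only [tv, Real.enorm_eq_ofReal_abs] using μ.enorm_le_totalVariation Set.univ

theorem KRnorm_le_tv [PseudoMetricSpace X] (p α β : ℝ) (μ : SignedMeasure X) :
    KRnorm p α β μ ≤ ENNReal.ofReal α * tv μ := by
  refine (iInf₂_le (0 : SignedMeasure X) (by simp)).trans ?_
  have hW : W p (0 : Measure X) 0 = 0 :=
    nonpos_iff_eq_zero.1 <| (iInf₂_le (0 : Measure (X × X)) (by simp [couplings])).trans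
      (by simp [transportCost])
  simp [pos, neg, tv, SignedMeasure.toJordanDecomposition_zero,
    SignedMeasure.totalVariation_zero, hW]

theorem le_KRnorm [PseudoMetricSpace X] (p α β : ℝ) (μ : SignedMeasure X) :
    ENNReal.ofReal α * ENNReal.ofReal |μ Set.univ| ≤ KRnorm p α β μ := by
  refine le_iInf₂ fun ν hν => le_add_left ?_
  gcongr
  simpa [hν] using ofReal_abs_univ_le_tv (μ - ν)

theorem KRnorm_smul_sDirac [PseudoMetricSpace X] (p β : ℝ) {α c : ℝ} (hα : 0 ≤ α) (hc : 0 ≤ c)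
    (z : X) : KRnorm p α β (c • sDirac z) = ENNReal.ofReal (α * c) := by
  rw [ENNReal.ofReal_mul hα]
  apply le_antisymm
  · simpa only [tv_smul_sDirac hc] using KRnorm_le_tv p α β (c • sDirac z)
  · have h := le_KRnorm p α β (c • sDirac z)
    rw [smul_sDirac_apply c z MeasurableSet.univ] at h
    simpa [abs_of_nonneg hc] using h

theorem KRnorm_neg_smul_sDirac_le [PseudoMetricSpace X] (p β : ℝ) {α c : ℝ} (hα : 0 ≤ α)
    (hc : 0 ≤ c) (z : X) : KRnorm p α β (-(c • sDirac z)) ≤ ENNReal.ofReal (α * c) := by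
  simpa only [ENNReal.ofReal_mul hα, tv_neg, tv_smul_sDirac hc] using
    KRnorm_le_tv p α β (-(c • sDirac z))

end KRnorm

/-- rescaled dipoles with `|x-y|^p ≥ 2α - β` are not extremal points
of the KR unit ball: they are a nontrivial convex combination of two rescaled Dirac
masses, and `‖c δ_z‖_{KR} = α c` for all `z ∈ Ω`, `c > 0`. -/
theorem dipole_not_extremePoint_KRball {n : ℕ} (Ω : Set (EuclideanSpace ℝ (Fin n)))
    (p α β : ℝ) (hp0 : 0 < p) (hp1 : p ≤ 1) (hα : 0 < α) (hβ : 0 < β)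
    (x y : ↥Ω) (hxy : x ≠ y) (hd : 2 * α - β ≤ dist x y ^ p) :
    (β + dist x y ^ p)⁻¹ • (sDirac x - sDirac y) ∉
        Set.extremePoints ℝ {μ : SignedMeasure ↥Ω | KRnorm p α β μ ≤ 1} ∧
      (β + dist x y ^ p)⁻¹ • (sDirac x - sDirac y) =
        (1 / 2 : ℝ) • ((2 / (β + dist x y ^ p)) • sDirac x) +
          (1 / 2 : ℝ) • (-((2 / (β + dist x y ^ p)) • sDirac y)) ∧
      ∀ (z : ↥Ω) (c : ℝ), 0 < c →
        KRnorm p α β (c • sDirac z) = ENNReal.ofReal (α * c) := by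
  have hD : 0 < β + dist x y ^ p := by positivity
  have hmid : (β + dist x y ^ p)⁻¹ • (sDirac x - sDirac y) =
      (1 / 2 : ℝ) • ((2 / (β + dist x y ^ p)) • sDirac x) +
        (1 / 2 : ℝ) • (-((2 / (β + dist x y ^ p)) • sDirac y)) := by
    module
  refine ⟨fun hext => ?_, hmid, fun z c hc => KRnorm_smul_sDirac p β hα.le hc.le z⟩
  have hc : 0 ≤ 2 / (β + dist x y ^ p) := by positivity
  have hle : ENNReal.ofReal (α * (2 / (β + dist x y ^ p))) ≤ 1 := by
    rw [ENNReal.ofReal_le_one, ← mul_div_assoc, div_le_one hD]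
    linarith
  have heq : (2 / (β + dist x y ^ p)) • sDirac x =
      (β + dist x y ^ p)⁻¹ • (sDirac x - sDirac y) :=
    hext.2 ((KRnorm_smul_sDirac p β hα.le hc x).le.trans hle)
      ((KRnorm_neg_smul_sDirac_le p β hα.le hc y).trans hle)
      ⟨1 / 2, 1 / 2, by norm_num, by norm_num, by norm_num, hmid.symm⟩
  have hy := congrArg (fun μ : SignedMeasure ↥Ω => μ {y}) heq
  simp only [smul_sub, _root_.sub_apply,
    smul_sDirac_apply _ _ (measurableSet_singleton y)] at hy
  simp [hxy] at hy
  exact hD.ne' hy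
end
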